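/- Let (R,m) be a noetherian local ring and let M be a non-zero R-module that is either finitely generated or m-adically complete, with finite Gorenstein flat dimension Gfd_R(M) < ∞. Then Gfd_R(M) = depth(m,R) − depth_R(m,M). -/

import Mathlib

/- ## Preliminary definitions -/

universe u

open IsLocalRing

noncomputable section

/-- The embedding dimension of a local ring: `dim_k (m/m²)`. -/
def embDim (R : Type u) [CommRing R] [IsLocalRing R] : ℕ :=
  Module.finrank (ResidueField R) (CotangentSpace R)

/-- Witness that `Q` is a Gorenstein flat `R`-module: a two-sided exact complex `F` of
flat modules, which stays exact after applying `I ⊗ᵣ -` for every injective module `I`,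
with `Q` isomorphic to the image of the differential `F₁ → F₀`. -/
structure GorensteinFlatWitness (R : Type u) [CommRing R] (Q : Type u) [AddCommGroup Q]
    [Module R Q] where
  F : ℤ → Type u
  [instAdd : ∀ i, AddCommGroup (F i)]
  [instMod : ∀ i, Module R (F i)]
  d : (i : ℤ) → F (i + 1) →ₗ[R] F i
  flat : ∀ i, Module.Flat R (F i)
  exact : ∀ i : ℤ, Function.Exact (d (i + 1)) (d i)
  exact_tensor : ∀ (I : Type u) [AddCommGroup I] [Module R I], Module.Injective R I →
    ∀ i : ℤ, Function.Exact (LinearMap.lTensor I (d (i + 1))) (LinearMap.lTensor I (d i))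
  iso : Nonempty (Q ≃ₗ[R] LinearMap.range (d 0))

/-- `Q` is a Gorenstein flat `R`-module. -/
def IsGorensteinFlat (R : Type u) [CommRing R] (Q : Type u) [AddCommGroup Q]
    [Module R Q] : Prop :=
  Nonempty (GorensteinFlatWitness R Q)

/-- Witness that `J` is a Gorenstein injective `R`-module: a two-sided exact complex `I` of
injective modules, which stays exact after applying `Hom_R(E, -)` for every injective module
`E`, with `J` isomorphic to the image of the differential `I₁ → I₀`. -/
structure GorensteinInjectiveWitness (R : Type u) [CommRing R] (J : Type u) [AddCommGroup J]
    [Module R J] where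
  I : ℤ → Type u
  [instAdd : ∀ i, AddCommGroup (I i)]
  [instMod : ∀ i, Module R (I i)]
  d : (i : ℤ) → I (i + 1) →ₗ[R] I i
  injective : ∀ i, Module.Injective R (I i)
  exact : ∀ i : ℤ, Function.Exact (d (i + 1)) (d i)
  exact_hom : ∀ (E : Type u) [AddCommGroup E] [Module R E], Module.Injective R E →
    ∀ i : ℤ, Function.Exact (LinearMap.llcomp R E (I (i + 1 + 1)) (I (i + 1)) (σ₁₂ := RingHom.id R) (σ₁₃ := RingHom.id R)
        (d (i + 1)))
      (LinearMap.llcomp R E (I (i + 1)) (I i) (σ₁₂ := RingHom.id R) (σ₁₃ := RingHom.id R) (d i))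
  iso : Nonempty (J ≃ₗ[R] LinearMap.range (d 0))

/-- `J` is a Gorenstein injective `R`-module. -/
def IsGorensteinInjective (R : Type u) [CommRing R] (J : Type u) [AddCommGroup J]
    [Module R J] : Prop :=
  Nonempty (GorensteinInjectiveWitness R J)

/-- A surjection onto `M` whose source is Gorenstein flat. -/
structure GorensteinFlatCover (R : Type u) [CommRing R] (M : Type u) [AddCommGroup M]
    [Module R M] where
  Q : Type u
  [instAdd : AddCommGroup Q]
  [instMod : Module R Q]
  π : Q →ₗ[R] M
  gflat : IsGorensteinFlat R Q
  surj : Function.Surjective π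

attribute [instance] GorensteinFlatCover.instAdd GorensteinFlatCover.instMod

/-- `M` admits an exact sequence `0 → Qₙ → ⋯ → Q₀ → M → 0` with all `Qᵢ` Gorenstein flat;
equivalently (by splicing), defined by recursion on `n`. -/
def gfdLE (R : Type u) [CommRing R] :
    (n : ℕ) → (M : Type u) → [AddCommGroup M] → [Module R M] → Prop
  | 0, M, _, _ => IsGorensteinFlat R M
  | n + 1, M, _, _ => ∃ c : GorensteinFlatCover R M, gfdLE R n (LinearMap.ker c.π)

/-- The Gorenstein flat dimension of `M` over `R`, as an element of `ℕ∞`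
(the zero module has Gorenstein flat dimension `0` here, and `⊤` means infinite). -/
def gfd (R : Type u) [CommRing R] (M : Type u) [AddCommGroup M] [Module R M] : ℕ∞ :=
  sInf ((↑) '' { n : ℕ | gfdLE R n M })

/-- A flat cover of `M`. -/
structure FlatCover (R : Type u) [CommRing R] (M : Type u) [AddCommGroup M]
    [Module R M] where
  Q : Type u
  [instAdd : AddCommGroup Q]
  [instMod : Module R Q]
  π : Q →ₗ[R] M
  flat : Module.Flat R Q
  surj : Function.Surjective π

attribute [instance] FlatCover.instAdd FlatCover.instMod

/-- `M` admits a flat resolution of length `≤ n`. -/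
def fdLE (R : Type u) [CommRing R] :
    (n : ℕ) → (M : Type u) → [AddCommGroup M] → [Module R M] → Prop
  | 0, M, _, _ => Module.Flat R M
  | n + 1, M, _, _ => ∃ c : FlatCover R M, fdLE R n (LinearMap.ker c.π)

/-- The flat dimension of `M` over `R`, as an element of `ℕ∞`. -/
def flatDim (R : Type u) [CommRing R] (M : Type u) [AddCommGroup M] [Module R M] : ℕ∞ :=
  sInf ((↑) '' { n : ℕ | fdLE R n M })

/-- An embedding of `M` into a Gorenstein injective module. -/
structure GorensteinInjectiveHull (R : Type u) [CommRing R] (M : Type u) [AddCommGroup M]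
    [Module R M] where
  J : Type u
  [instAdd : AddCommGroup J]
  [instMod : Module R J]
  ι : M →ₗ[R] J
  ginj : IsGorensteinInjective R J
  inj : Function.Injective ι

attribute [instance] GorensteinInjectiveHull.instAdd GorensteinInjectiveHull.instMod

/-- `M` admits an exact sequence `0 → M → J₀ → ⋯ → J₋ₙ → 0` with all `Jᵢ`
Gorenstein injective. -/
def gidLE (R : Type u) [CommRing R] :
    (n : ℕ) → (M : Type u) → [AddCommGroup M] → [Module R M] → Prop
  | 0, M, _, _ => IsGorensteinInjective R M
  | n + 1, M, _, _ => ∃ c : GorensteinInjectiveHull R M,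
      gidLE R n (c.J ⧸ LinearMap.range c.ι)

/-- The Gorenstein injective dimension of `M` over `R`, as an element of `ℕ∞`. -/
def gid (R : Type u) [CommRing R] (M : Type u) [AddCommGroup M] [Module R M] : ℕ∞ :=
  sInf ((↑) '' { n : ℕ | gidLE R n M })

/-- An embedding of `M` into an injective module. -/
structure InjectiveHullStep (R : Type u) [CommRing R] (M : Type u) [AddCommGroup M]
    [Module R M] where
  J : Type u
  [instAdd : AddCommGroup J]
  [instMod : Module R J]
  ι : M →ₗ[R] J
  injective : Module.Injective R J
  inj : Function.Injective ι

attribute [instance] InjectiveHullStep.instAdd InjectiveHullStep.instMod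

/-- `M` admits an injective resolution of length `≤ n`. -/
def idLE (R : Type u) [CommRing R] :
    (n : ℕ) → (M : Type u) → [AddCommGroup M] → [Module R M] → Prop
  | 0, M, _, _ => Module.Injective R M
  | n + 1, M, _, _ => ∃ c : InjectiveHullStep R M, idLE R n (c.J ⧸ LinearMap.range c.ι)

/-- The injective dimension of `M` over `R`, as an element of `ℕ∞`. -/
def injDim (R : Type u) [CommRing R] (M : Type u) [AddCommGroup M] [Module R M] : ℕ∞ :=
  sInf ((↑) '' { n : ℕ | idLE R n M })

/-- The `i`-th Ext module `Ext_R^i(N, M)`. -/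
def extModule (R : Type u) [CommRing R] (i : ℕ) (N M : Type u) [AddCommGroup N] [Module R N]
    [AddCommGroup M] [Module R M] : ModuleCat.{u} R :=
  ((Ext R (ModuleCat.{u} R) i).obj (Opposite.op (ModuleCat.of R N))).obj (ModuleCat.of R M)

/-- The depth of `M` with respect to the ideal `I`: the least `i` such that
`Ext_R^i(R/I, M) ≠ 0` (with value `⊤ : ℕ∞` if no such `i` exists). -/
def idealDepth (R : Type u) [CommRing R] (I : Ideal R) (M : Type u) [AddCommGroup M]
    [Module R M] : ℕ∞ :=
  sInf ((↑) '' { i : ℕ | ¬ Subsingleton (extModule R i (R ⧸ I) M) })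

/-- A finitely generated `S`-module `M` is totally reflexive if the biduality map
`M → Hom_S(Hom_S(M,S),S)` is bijective and `Ext_S^i(M,S) = 0 = Ext_S^i(M^*,S)`
for all `i ≥ 1`. -/
def IsTotallyReflexive (S : Type u) [CommRing S] (M : Type u) [AddCommGroup M]
    [Module S M] : Prop :=
  Module.Finite S M ∧ Function.Bijective (Module.Dual.eval S M) ∧
    ∀ i : ℕ, 1 ≤ i → Subsingleton (extModule S i M S) ∧
      Subsingleton (extModule S i (Module.Dual S M) S)

/-- A noetherian local ring is G-regular if every totally reflexive module is free. -/
def IsGRegular (S : Type u) [CommRing S] : Prop :=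
  ∀ (M : Type u) [AddCommGroup M] [Module S M], IsTotallyReflexive S M → Module.Free S M

/-- A commutative ring is a regular local ring if it is a noetherian local ring whose
maximal ideal is generated by a regular sequence. -/
def IsRegularLocal (A : Type u) [CommRing A] : Prop :=
  IsNoetherianRing A ∧ ∃ h : IsLocalRing A, ∃ rs : List A,
    RingTheory.Sequence.IsRegular A rs ∧
      Ideal.span { x | x ∈ rs } = @IsLocalRing.maximalIdeal A _ h

/-- A Gorenstein local ring: a noetherian local ring of finite self-injective dimension. -/
def IsGorensteinLocal (A : Type u) [CommRing A] : Prop :=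
  IsNoetherianRing A ∧ IsLocalRing A ∧ injDim A A < ⊤

/-- `E` is an injective envelope (injective hull) of the residue field of the local
ring `S`: an injective module containing the residue field as an essential submodule. -/
def IsInjEnvResidueField (S : Type u) [CommRing S] [IsLocalRing S] (E : Type u)
    [AddCommGroup E] [Module S E] : Prop :=
  Module.Injective S E ∧ ∃ ι : ResidueField S →ₗ[S] E, Function.Injective ι ∧
    ∀ N : Submodule S E, N ≠ ⊥ → N ⊓ LinearMap.range ι ≠ ⊥

end

namespace GFlat

open CategoryTheory Abelian IsLocalRing

variable {R : Type u} [CommRing R]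

/-- A short exact sequence `0 → A → B → C → 0` of modules. -/
structure SES (R : Type u) [CommRing R] (A B C : Type u) [AddCommGroup A] [Module R A]
    [AddCommGroup B] [Module R B] [AddCommGroup C] [Module R C] where
  f : A →ₗ[R] B
  g : B →ₗ[R] C
  inj : Function.Injective f
  surj : Function.Surjective g
  exact : Function.Exact f g

section SES

variable {A B C : Type u} [AddCommGroup A] [Module R A]
    [AddCommGroup B] [Module R B] [AddCommGroup C] [Module R C]

lemma SES.gf (S : SES R A B C) (a : A) : S.g (S.f a) = 0 := S.exact.apply_apply_eq_zero a

lemma SES.lift (S : SES R A B C) {b : B} (h : S.g b = 0) : ∃ a, S.f a = b := (S.exact b).1 h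

/-- The short exact sequence of a surjection and its kernel. -/
noncomputable def SES.ofSurj (g : B →ₗ[R] C) (hg : Function.Surjective g) :
    SES R (LinearMap.ker g) B C where
  f := (LinearMap.ker g).subtype
  g := g
  inj := Subtype.val_injective
  surj := hg
  exact := fun b => by simp

/-- The short exact sequence of an injection and its cokernel. -/
noncomputable def SES.ofInj (f : A →ₗ[R] B) (hf : Function.Injective f) :
    SES R A B (B ⧸ LinearMap.range f) where
  f := f
  g := (LinearMap.range f).mkQ
  inj := hf
  surj := Submodule.mkQ_surjective _
  exact := fun b => by simp

/-- The short exact sequence of a submodule and its quotient. -/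
noncomputable def SES.ofSub (N : Submodule R B) : SES R N B (B ⧸ N) where
  f := N.subtype
  g := N.mkQ
  inj := Subtype.val_injective
  surj := Submodule.mkQ_surjective _
  exact := fun b => by simp

/-- Replace the left term of a short exact sequence by an isomorphic module. -/
noncomputable def SES.congrLeft {A' : Type u} [AddCommGroup A'] [Module R A']
    (S : SES R A B C) (e : A' ≃ₗ[R] A) : SES R A' B C where
  f := S.f ∘ₗ e.toLinearMap
  g := S.g
  inj := S.inj.comp e.injective
  surj := S.surj
  exact := fun b => by
    rw [S.exact b]
    constructor
    · rintro ⟨a, rfl⟩; exact ⟨e.symm a, by simp⟩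
    · rintro ⟨a, rfl⟩; exact ⟨e a, by simp⟩

/-- The dual sequence under character modules. -/
noncomputable def SES.dual (S : SES R A B C) :
    SES R (CharacterModule C) (CharacterModule B) (CharacterModule A) where
  f := CharacterModule.dual S.g
  g := CharacterModule.dual S.f
  inj := CharacterModule.dual_injective_of_surjective _ S.surj
  surj := CharacterModule.dual_surjective_of_injective _ S.inj
  exact := fun φ => by
    constructor
    · intro h
      have h' : ∀ a, φ (S.f a) = 0 := fun a => DFunLike.congr_fun h a
      have hk : S.g.toAddMonoidHom.ker ≤ AddMonoidHom.ker φ := by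
        intro b hb
        obtain ⟨a, rfl⟩ := S.lift hb
        exact h' a
      refine ⟨S.g.toAddMonoidHom.liftOfRightInverse (Function.surjInv S.surj)
        (Function.rightInverse_surjInv S.surj) ⟨φ, hk⟩, ?_⟩
      ext b
      exact S.g.toAddMonoidHom.liftOfRightInverse_comp_apply _
        (Function.rightInverse_surjInv S.surj) ⟨φ, hk⟩ b
    · rintro ⟨ψ, rfl⟩
      ext a
      change ψ (S.g (S.f a)) = 0
      rw [S.gf, map_zero]

lemma SES.shortExact (S : SES R A B C) :
    (ShortComplex.mk (ModuleCat.ofHom S.f) (ModuleCat.ofHom S.g)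
      (by ext a; exact S.gf a)).ShortExact where
  exact := (ShortComplex.ShortExact.moduleCat_exact_iff_function_exact _).2 S.exact
  mono_f := (ModuleCat.mono_iff_injective _).2 S.inj
  epi_g := (ModuleCat.epi_iff_surjective _).2 S.surj

end SES

section Ext

/-- `s` annihilates `Ext^i(N, V)`. -/
def ExtKill (s : R) (i : ℕ) (N V : Type u) [AddCommGroup N] [Module R N]
    [AddCommGroup V] [Module R V] : Prop :=
  ∀ e : Abelian.Ext (ModuleCat.of R N) (ModuleCat.of R V) i, s • e = 0

variable (R) in
/-- `Ext^i(N, V)` vanishes. -/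
def ExtZ (i : ℕ) (N V : Type u) [AddCommGroup N] [Module R N]
    [AddCommGroup V] [Module R V] : Prop :=
  ExtKill (1 : R) i N V

variable {A B C : Type u} [AddCommGroup A] [Module R A]
    [AddCommGroup B] [Module R B] [AddCommGroup C] [Module R C]
    {N V : Type u} [AddCommGroup N] [Module R N] [AddCommGroup V] [Module R V]

lemma ExtZ.eq_zero {i : ℕ} (h : ExtZ R i N V)
    (e : Abelian.Ext (ModuleCat.of R N) (ModuleCat.of R V) i) : e = 0 := by simpa using h e

lemma extZ_of_forall {i : ℕ}
    (h : ∀ e : Abelian.Ext (ModuleCat.of R N) (ModuleCat.of R V) i, e = 0) : ExtZ R i N V :=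
  fun e => by simpa using h e

lemma ExtKill.contra_mid (S : SES R A B C) {s t : R} {i : ℕ} (hA : ExtKill s i A V)
    (hC : ExtKill t i C V) : ExtKill (s * t) i B V := fun e => by
  obtain ⟨e', he'⟩ := Abelian.Ext.contravariant_sequence_exact₂ S.shortExact (ModuleCat.of R V)
    (s • e) (by rw [Abelian.Ext.comp_smul]; exact hA _)
  rw [mul_comm, mul_smul, ← he', ← Abelian.Ext.comp_smul, show t • e' = 0 from hC e',
    Abelian.Ext.comp_zero]

lemma ExtKill.contra_left (S : SES R A B C) {s t : R} {i : ℕ} (hB : ExtKill s i B V)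
    (hC : ExtKill t (i + 1) C V) : ExtKill (s * t) i A V := fun e => by
  obtain ⟨e', he'⟩ := Abelian.Ext.contravariant_sequence_exact₁ S.shortExact (ModuleCat.of R V)
    (t • e) (add_comm 1 i) (by rw [Abelian.Ext.comp_smul]; exact hC _)
  rw [mul_smul, ← he', ← Abelian.Ext.comp_smul, show s • e' = 0 from hB e',
    Abelian.Ext.comp_zero]

lemma ExtKill.contra_right (S : SES R A B C) {s t : R} {i : ℕ} (hA : ExtKill s i A V)
    (hB : ExtKill t (i + 1) B V) : ExtKill (s * t) (i + 1) C V := fun e => by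
  obtain ⟨e', he'⟩ := Abelian.Ext.contravariant_sequence_exact₃ S.shortExact (ModuleCat.of R V)
    (t • e) (by rw [Abelian.Ext.comp_smul]; exact hB _) (add_comm 1 i)
  rw [mul_smul, ← he', ← Abelian.Ext.comp_smul, show s • e' = 0 from hA e',
    Abelian.Ext.comp_zero]

lemma ExtKill.co_mid (S : SES R A B C) {s t : R} {i : ℕ} (hA : ExtKill s i N A)
    (hC : ExtKill t i N C) : ExtKill (s * t) i N B := fun e => by
  obtain ⟨e', he'⟩ := Abelian.Ext.covariant_sequence_exact₂ (ModuleCat.of R N) S.shortExact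
    (t • e) (by rw [Abelian.Ext.smul_comp]; exact hC _)
  rw [mul_smul, ← he', ← Abelian.Ext.smul_comp, show s • e' = 0 from hA e',
    Abelian.Ext.zero_comp]

lemma ExtKill.co_left (S : SES R A B C) {s t : R} {i : ℕ} (hB : ExtKill s (i + 1) N B)
    (hC : ExtKill t i N C) : ExtKill (s * t) (i + 1) N A := fun e => by
  obtain ⟨e', he'⟩ := Abelian.Ext.covariant_sequence_exact₁ (ModuleCat.of R N) S.shortExact
    (s • e) (by rw [Abelian.Ext.smul_comp]; exact hB _) rfl
  rw [mul_comm, mul_smul, ← he', ← Abelian.Ext.smul_comp, show t • e' = 0 from hC e',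
    Abelian.Ext.zero_comp]

lemma ExtKill.co_right (S : SES R A B C) {s t : R} {i : ℕ} (hB : ExtKill s i N B)
    (hA : ExtKill t (i + 1) N A) : ExtKill (s * t) i N C := fun e => by
  obtain ⟨e', he'⟩ := Abelian.Ext.covariant_sequence_exact₃ (ModuleCat.of R N) S.shortExact
    (t • e) rfl (by rw [Abelian.Ext.smul_comp]; exact hA _)
  rw [mul_smul, ← he', ← Abelian.Ext.smul_comp, show s • e' = 0 from hB e',
    Abelian.Ext.zero_comp]

/-- Multiplication by an element killing the first argument kills `Ext`. -/
lemma extKill_of_smul_left {s : R} (h : ∀ n : N, s • n = 0) (i : ℕ) : ExtKill s i N V := fun e => by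
  have : s • e = (s • Abelian.Ext.mk₀ (𝟙 (ModuleCat.of R N))).comp e (zero_add i) := by
    rw [Abelian.Ext.smul_comp, Abelian.Ext.mk₀_id_comp]
  rw [this, ← Abelian.Ext.mk₀_smul,
    show s • 𝟙 (ModuleCat.of R N) = 0 by ext n; exact h n]
  simp

lemma extZ_of_projective [Module.Projective R N] (i : ℕ) : ExtZ R (i + 1) N V := by
  have : Projective (ModuleCat.of R N) := (IsProjective.iff_projective N).1 inferInstance
  exact extZ_of_forall fun e => Abelian.Ext.eq_zero_of_projective e

lemma extZ_of_injective [Module.Injective R V] (i : ℕ) : ExtZ R (i + 1) N V := by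
  have : Injective (ModuleCat.of R V) := Module.injective_object_of_injective_module R V
  exact extZ_of_forall fun e => Abelian.Ext.eq_zero_of_injective e

lemma ExtZ.contra_mid (S : SES R A B C) {i : ℕ} (hA : ExtZ R i A V)
    (hC : ExtZ R i C V) : ExtZ R i B V := by
  simpa [ExtZ] using ExtKill.contra_mid S hA hC

lemma ExtZ.contra_left (S : SES R A B C) {i : ℕ} (hB : ExtZ R i B V)
    (hC : ExtZ R (i + 1) C V) : ExtZ R i A V := by
  simpa [ExtZ] using ExtKill.contra_left S hB hC

lemma ExtZ.co_mid (S : SES R A B C) {i : ℕ} (hA : ExtZ R i N A)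
    (hC : ExtZ R i N C) : ExtZ R i N B := by
  simpa [ExtZ] using ExtKill.co_mid S hA hC

lemma ExtZ.co_left (S : SES R A B C) {i : ℕ} (hB : ExtZ R (i + 1) N B)
    (hC : ExtZ R i N C) : ExtZ R (i + 1) N A := by
  simpa [ExtZ] using ExtKill.co_left S hB hC

lemma ExtZ.co_right (S : SES R A B C) {i : ℕ} (hB : ExtZ R i N B)
    (hA : ExtZ R (i + 1) N A) : ExtZ R i N C := by
  simpa [ExtZ] using ExtKill.co_right S hB hA

/-- The linear map attached to an `Ext` class of degree zero vanishes iff the class does. -/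
lemma extZ_zero_iff : ExtZ R 0 N V ↔ ∀ f : N →ₗ[R] V, f = 0 := by
  constructor
  · intro h f
    have := h.eq_zero (Abelian.Ext.mk₀ (ModuleCat.ofHom f))
    rw [Abelian.Ext.mk₀_eq_zero_iff] at this
    simpa using congrArg ModuleCat.Hom.hom this
  · intro h
    refine extZ_of_forall fun e => ?_
    obtain ⟨f, rfl⟩ := (Abelian.Ext.mk₀_bijective _ _).2 e
    rw [Abelian.Ext.mk₀_eq_zero_iff]
    ext x
    exact DFunLike.congr_fun (h f.hom) x

lemma ExtKill.congr_right {s : R} {i : ℕ} (h : ExtKill s i N V) (e : V ≃ₗ[R] A) :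
    ExtKill s i N A := fun x => by
  have h1 := h (x.comp (Abelian.Ext.mk₀ (ModuleCat.ofHom e.symm.toLinearMap)) (add_zero i))
  have h2 : x = (x.comp (Abelian.Ext.mk₀ (ModuleCat.ofHom e.symm.toLinearMap)) (add_zero i)).comp
      (Abelian.Ext.mk₀ (ModuleCat.ofHom e.toLinearMap)) (add_zero i) := by
    rw [Abelian.Ext.comp_assoc_of_second_deg_zero, Abelian.Ext.mk₀_comp_mk₀, ← ModuleCat.ofHom_comp]
    simp
  rw [h2, ← Abelian.Ext.smul_comp, h1, Abelian.Ext.zero_comp]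

lemma ExtZ.congr_right {i : ℕ} (h : ExtZ R i N V) (e : V ≃ₗ[R] A) : ExtZ R i N A :=
  ExtKill.congr_right h e

lemma subsingleton_extModule_iff (i : ℕ) :
    Subsingleton (extModule R i N V) ↔ ExtZ R i N V := by
  let P := projectiveResolution (ModuleCat.of R N)
  have h1 : Subsingleton (extModule R i N V) ↔
      (P.complex.linearYonedaObj R (ModuleCat.of R V)).ExactAt i := by
    rw [HomologicalComplex.exactAt_iff_isZero_homology, ← ModuleCat.isZero_iff_subsingleton]
    exact (P.isoExt i (ModuleCat.of R V)).isZero_iff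
  rw [h1]
  cases i with
  | zero =>
    rw [HomologicalComplex.exactAt_iff' _ 0 0 1 (by simp) (by simp),
      ShortComplex.moduleCat_exact_iff, extZ_zero_iff]
    constructor
    · intro h f
      have key : ∀ q : ((ChainComplex.single₀ (ModuleCat R)).obj (ModuleCat.of R N)).X 0 ⟶
          ModuleCat.of R V, q = 0 := by
        intro q
        have hq : P.complex.d 1 0 ≫ P.π.f 0 ≫ q = 0 := by
          rw [← Category.assoc, P.complex_d_comp_π_f_zero, Limits.zero_comp]
        obtain ⟨x, hx⟩ := h (P.π.f 0 ≫ q) hq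
        have hx' : P.complex.d 0 0 ≫ (show P.complex.X 0 ⟶ ModuleCat.of R V from x) =
          P.π.f 0 ≫ q := hx
        rw [P.complex.shape _ _ (by simp), Limits.zero_comp] at hx'
        rw [← cancel_epi (P.π.f 0), Limits.comp_zero, hx']
      exact congrArg ModuleCat.Hom.hom (key (ModuleCat.ofHom f))
    · intro h f hf
      have hf' : P.complex.d 1 0 ≫ (show P.complex.X 0 ⟶ ModuleCat.of R V from f) = 0 := hf
      have hd := P.exact₀.g_desc _ hf'
      have h0 : P.exact₀.desc _ hf' = 0 := by
        ext x
        exact DFunLike.congr_fun (h (P.exact₀.desc _ hf').hom) x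
      rw [h0, Limits.comp_zero] at hd
      exact ⟨0, by rw [map_zero]; exact hd⟩
  | succ i =>
    rw [HomologicalComplex.exactAt_iff' _ i (i + 1) (i + 1 + 1) (by simp) (by simp),
      ShortComplex.moduleCat_exact_iff]
    constructor
    · intro h
      refine extZ_of_forall fun e => ?_
      obtain ⟨f, hf, rfl⟩ := P.extMk_surjective e (i + 1 + 1) rfl
      rw [P.extMk_eq_zero_iff _ _ _ _ i rfl]
      obtain ⟨g, hg⟩ := h f hf
      exact ⟨g, hg⟩
    · intro h f hf
      have := h.eq_zero (P.extMk f (i + 1 + 1) rfl hf)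
      exact (P.extMk_eq_zero_iff _ _ _ _ i rfl).1 this

end Ext

end GFlat

namespace GFlat

open CategoryTheory Abelian IsLocalRing

variable {R : Type u} [CommRing R]

section Lifting

variable {A B C : Type u} [AddCommGroup A] [Module R A]
    [AddCommGroup B] [Module R B] [AddCommGroup C] [Module R C]
    {N V : Type u} [AddCommGroup N] [Module R N] [AddCommGroup V] [Module R V]

lemma ExtZ.exists_lift (S : SES R A B C) (h : ExtZ R 1 N A) (φ : N →ₗ[R] C) :
    ∃ ψ : N →ₗ[R] B, S.g ∘ₗ ψ = φ := by
  obtain ⟨e, he⟩ := Abelian.Ext.covariant_sequence_exact₃ (ModuleCat.of R N) S.shortExact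
    (Abelian.Ext.mk₀ (ModuleCat.ofHom φ)) (zero_add 1) (h.eq_zero _)
  obtain ⟨ψ, rfl⟩ := (Abelian.Ext.mk₀_bijective _ _).2 e
  rw [Abelian.Ext.mk₀_comp_mk₀] at he
  exact ⟨ψ.hom, congrArg ModuleCat.Hom.hom ((Abelian.Ext.mk₀_bijective _ _).1 he)⟩

lemma extZ_one_of_exists_lift (S : SES R A B C) (hB : ExtZ R 1 N B)
    (h : ∀ φ : N →ₗ[R] C, ∃ ψ : N →ₗ[R] B, S.g ∘ₗ ψ = φ) : ExtZ R 1 N A := by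
  refine extZ_of_forall fun e => ?_
  obtain ⟨e', rfl⟩ := Abelian.Ext.covariant_sequence_exact₁ (ModuleCat.of R N) S.shortExact
    e (hB.eq_zero _) (zero_add 1)
  obtain ⟨φ, rfl⟩ := (Abelian.Ext.mk₀_bijective _ _).2 e'
  obtain ⟨ψ, hψ⟩ := h φ.hom
  have : φ = ModuleCat.ofHom ψ ≫ ModuleCat.ofHom S.g := by
    ext x; exact (DFunLike.congr_fun hψ x).symm
  rw [this, ← Abelian.Ext.mk₀_comp_mk₀]
  rw [Abelian.Ext.comp_assoc_of_second_deg_zero]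
  have := S.shortExact.comp_extClass
  dsimp at this
  rw [this, Abelian.Ext.comp_zero]

lemma ExtZ.exists_extend (S : SES R A B C) (h : ExtZ R 1 C V) (φ : A →ₗ[R] V) :
    ∃ ψ : B →ₗ[R] V, ψ ∘ₗ S.f = φ := by
  obtain ⟨e, he⟩ := Abelian.Ext.contravariant_sequence_exact₁ S.shortExact (ModuleCat.of R V)
    (Abelian.Ext.mk₀ (ModuleCat.ofHom φ)) (add_zero 1) (h.eq_zero _)
  obtain ⟨ψ, rfl⟩ := (Abelian.Ext.mk₀_bijective _ _).2 e
  rw [Abelian.Ext.mk₀_comp_mk₀] at he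
  exact ⟨ψ.hom, congrArg ModuleCat.Hom.hom ((Abelian.Ext.mk₀_bijective _ _).1 he)⟩

lemma baer_of_extZ_one (h : ∀ I : Ideal R, ExtZ R 1 (R ⧸ I) V) : Module.Baer R V := by
  intro I g
  obtain ⟨ψ, hψ⟩ := (h I).exists_extend (SES.ofSub I) g
  exact ⟨ψ, fun x hx => DFunLike.congr_fun hψ ⟨x, hx⟩⟩

/-- A character vanishing on the kernel of a linear map factors through it. -/
lemma exists_character_factor (g : B →ₗ[R] C) (φ : CharacterModule B)
    (h : ∀ b, g b = 0 → φ b = 0) : ∃ ψ : CharacterModule C, ∀ b, ψ (g b) = φ b := by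
  let S := SES.ofSurj g.rangeRestrict g.surjective_rangeRestrict
  obtain ⟨ψ, hψ⟩ := S.dual.lift (b := φ) (by
    ext b
    exact h b.1 (congrArg Subtype.val b.2))
  obtain ⟨χ, rfl⟩ := CharacterModule.dual_surjective_of_injective (LinearMap.range g).subtype
    Subtype.val_injective ψ
  exact ⟨χ, fun b => DFunLike.congr_fun hψ b⟩

end Lifting

section TV

variable (R) in
/-- Vanishing of `Tor_i(N, A)`, expressed through the character module of `A`. -/
def TV (i : ℕ) (N A : Type u) [AddCommGroup N] [Module R N] [AddCommGroup A] [Module R A] : Prop :=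
  ExtZ R i N (CharacterModule A)

variable {A B C : Type u} [AddCommGroup A] [Module R A]
    [AddCommGroup B] [Module R B] [AddCommGroup C] [Module R C]
    {N N' N'' : Type u} [AddCommGroup N] [Module R N] [AddCommGroup N'] [Module R N']
    [AddCommGroup N''] [Module R N'']

lemma TV.left (S : SES R A B C) {i : ℕ} (hB : TV R i N B) (hC : TV R (i + 1) N C) : TV R i N A :=
  ExtZ.co_right S.dual hB hC

lemma TV.mid (S : SES R A B C) {i : ℕ} (hA : TV R i N A) (hC : TV R i N C) : TV R i N B :=
  ExtZ.co_mid S.dual hC hA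

lemma TV.right (S : SES R A B C) {i : ℕ} (hA : TV R i N A) (hB : TV R (i + 1) N B) :
    TV R (i + 1) N C :=
  ExtZ.co_left S.dual hB hA

lemma TV.congr {i : ℕ} (h : TV R i N A) (e : A ≃ₗ[R] B) : TV R i N B :=
  ExtZ.congr_right h (CharacterModule.congr e)

lemma TV.of_subsingleton [Subsingleton A] (i : ℕ) : TV R i N A := by
  have : ∀ v : CharacterModule A, (0 : R) • v = v := fun v => by
    ext a; rw [Subsingleton.elim a 0, map_zero, map_zero]
  refine extZ_of_forall fun e => ?_
  have h1 : 𝟙 (ModuleCat.of R (CharacterModule A)) = 0 := by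
    ext v a
    exact DFunLike.congr_fun ((this v).symm.trans (zero_smul R v)) a
  rw [← Abelian.Ext.comp_mk₀_id e, h1]
  simp

lemma tv_of_flat [Module.Flat R A] (i : ℕ) : TV R (i + 1) N A := by
  have := (Module.Flat.iff_characterModule_injective (R := R) (M := A)).1 inferInstance
  exact extZ_of_injective i

lemma flat_of_tv (h : ∀ I : Ideal R, TV R 1 (R ⧸ I) A) : Module.Flat R A :=
  Module.Flat.iff_characterModule_baer.2 (baer_of_extZ_one h)

lemma exists_lift_dual_iff (f : A →ₗ[R] B) : Function.Injective (f.lTensor N) ↔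
    ∀ φ : N →ₗ[R] CharacterModule A, ∃ ψ : N →ₗ[R] CharacterModule B,
      CharacterModule.dual f ∘ₗ ψ = φ := by
  rw [← CharacterModule.dual_surjective_iff_injective]
  constructor
  · intro h φ
    obtain ⟨χ, hχ⟩ := h (CharacterModule.homEquiv φ)
    refine ⟨CharacterModule.homEquiv.symm χ, ?_⟩
    apply CharacterModule.homEquiv.injective
    rw [← hχ]
    ext z
    induction z with
    | zero => rw [map_zero, map_zero]
    | add x y hx hy => rw [map_add, map_add, hx, hy]
    | tmul n a => simp; rfl
  · intro h χ
    obtain ⟨ψ, hψ⟩ := h (CharacterModule.homEquiv.symm χ)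
    refine ⟨CharacterModule.homEquiv ψ, ?_⟩
    apply CharacterModule.homEquiv.symm.injective
    rw [← hψ]
    rfl

lemma TV.lTensor_injective (S : SES R A B C) (h : TV R 1 N C) :
    Function.Injective (S.f.lTensor N) :=
  (exists_lift_dual_iff S.f).2 fun φ => ExtZ.exists_lift S.dual h φ

lemma tv_one_of_lTensor_injective (S : SES R A B C) (hB : TV R 1 N B)
    (h : Function.Injective (S.f.lTensor N)) : TV R 1 N C :=
  extZ_one_of_exists_lift S.dual hB ((exists_lift_dual_iff S.f).1 h)

lemma TV.contra_mid (S : SES R N N' N'') {i : ℕ} (h : TV R i N A) (h' : TV R i N'' A) :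
    TV R i N' A := ExtZ.contra_mid S h h'

lemma TV.contra_left (S : SES R N N' N'') {i : ℕ} (h : TV R i N' A) (h' : TV R (i + 1) N'' A) :
    TV R i N A := ExtZ.contra_left S h h'

end TV

section FD

/-- Flat dimension at most `n`, expressed by vanishing of all higher `Tor`. -/
def FD (R : Type u) [CommRing R] (n : ℕ) (H : Type u) [AddCommGroup H] [Module R H] : Prop :=
  ∀ (N : ModuleCat.{u} R) (i : ℕ), n < i → TV R i N H

variable {A B C : Type u} [AddCommGroup A] [Module R A]
    [AddCommGroup B] [Module R B] [AddCommGroup C] [Module R C]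

lemma FD.tv {n : ℕ} (h : FD R n A) (N : Type u) [AddCommGroup N] [Module R N] {i : ℕ} (hi : n < i) :
    TV R i N A := h (ModuleCat.of R N) i hi

lemma FD.mono {m n : ℕ} (h : FD R m A) (hmn : m ≤ n) : FD R n A :=
  fun N i hi => h N i (lt_of_le_of_lt hmn hi)

lemma fd_of_flat [Module.Flat R A] (n : ℕ) : FD R n A := fun N i hi => by
  obtain ⟨j, rfl⟩ : ∃ j, i = j + 1 := ⟨i - 1, by omega⟩
  exact tv_of_flat j

lemma FD.flat (h : FD R 0 A) : Module.Flat R A := flat_of_tv fun _ => h.tv _ zero_lt_one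

lemma FD.left (S : SES R A B C) {n : ℕ} (hB : FD R n B) (hC : FD R (n + 1) C) : FD R n A :=
  fun N i hi => TV.left S (hB N i hi) (hC N (i + 1) (by omega))

lemma FD.mid (S : SES R A B C) {n : ℕ} (hA : FD R n A) (hC : FD R n C) : FD R n B :=
  fun N i hi => TV.mid S (hA N i hi) (hC N i hi)

lemma FD.right (S : SES R A B C) {n : ℕ} (hA : FD R n A) (hB : FD R (n + 1) B) :
    FD R (n + 1) C := fun N i hi => by
  obtain ⟨j, rfl⟩ : ∃ j, i = j + 1 := ⟨i - 1, by omega⟩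
  exact TV.right S (hA N j (by omega)) (hB N _ hi)

lemma FD.congr {n : ℕ} (h : FD R n A) (e : A ≃ₗ[R] B) : FD R n B := fun N i hi => (h N i hi).congr e

lemma FD.flat_left (S : SES R A B C) [Module.Flat R B] (hC : FD R 1 C) : Module.Flat R A :=
  (FD.left S (fd_of_flat 0) hC).flat

lemma flat_mid (S : SES R A B C) [Module.Flat R A] [Module.Flat R C] : Module.Flat R B :=
  (FD.mid S (fd_of_flat 0) (fd_of_flat 0)).flat

/-- A free module surjecting onto a given module. -/
lemma exists_free_cover (A : Type u) [AddCommGroup A] [Module R A] :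
    ∃ (G : ModuleCat.{u} R) (_ : Module.Free R G) (π : G →ₗ[R] A), Function.Surjective π :=
  ⟨ModuleCat.of R (A →₀ R), inferInstanceAs (Module.Free R (A →₀ R)),
    Finsupp.linearCombination R id, Finsupp.linearCombination_id_surjective R A⟩

/-- If the top `Tor` against all cyclic modules vanishes the flat dimension drops. -/
lemma FD.pred {n : ℕ} (h : FD R (n + 1) A) (h' : ∀ I : Ideal R, TV R (n + 1) (R ⧸ I) A) :
    FD R n A := by
  induction n generalizing A with
  | zero =>
    have := flat_of_tv h'
    exact fd_of_flat 0
  | succ n ih =>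
    obtain ⟨G, _, π, hπ⟩ := exists_free_cover (R := R) A
    let S := SES.ofSurj π hπ
    have hK : FD R (n + 1) (LinearMap.ker π) := FD.left S (fd_of_flat _) h
    exact FD.right S (ih hK fun I => TV.left S (tv_of_flat _) (h' I)) (fd_of_flat _)

/-- If the top `Tor` against all injective modules vanishes the flat dimension drops. -/
lemma FD.pred_of_injective {n : ℕ} (h : FD R (n + 1) A)
    (h' : ∀ E : ModuleCat.{u} R, Module.Injective R E → TV R (n + 1) E A) : FD R n A := by
  refine h.pred fun I => ?_
  let X := ModuleCat.of R (R ⧸ I)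
  let f : X ⟶ Injective.under X := Injective.ι X
  have hf : Function.Injective f.hom := (ModuleCat.mono_iff_injective f).1 inferInstance
  have hE : Module.Injective R (Injective.under X : ModuleCat.{u} R) :=
    Module.injective_module_of_injective_object R _
      (inj := (inferInstance : Injective (Injective.under X)))
  exact TV.contra_left (SES.ofInj f.hom hf) (h' _ hE) (h.tv _ (by omega))

end FD

end GFlat

namespace GFlat

open CategoryTheory Abelian IsLocalRing

variable {R : Type u} [CommRing R]

section Relations

/-- Over a noetherian ring, relations with fixed coefficients in all flat modules are generated
by a single finite matrix. -/
lemma exists_relation_matrix [IsNoetherianRing R] {l : ℕ} (f : Fin l → R) :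
    ∃ (k : ℕ) (a : Fin l → Fin k → R), (∀ j, ∑ i, f i * a i j = 0) ∧
      (∀ c : Fin l → R, ∑ i, f i * c i = 0 → ∃ b : Fin k → R, ∀ i, c i = ∑ j, a i j * b j) ∧
      ∀ (F : Type u) [AddCommGroup F] [Module R F] [Module.Flat R F] (x : Fin l → F),
        ∑ i, f i • x i = 0 → ∃ y : Fin k → F, ∀ i, x i = ∑ j, a i j • y j := by
  let L : (Fin l → R) →ₗ[R] R := Fintype.linearCombination R f
  have hL : ∀ c, L c = ∑ i, f i * c i := fun c => by
    simp [L, Fintype.linearCombination_apply, mul_comm]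
  obtain ⟨k, s, hs⟩ := Submodule.fg_iff_exists_fin_generating_family.1
    (IsNoetherian.noetherian (LinearMap.ker L))
  have hsyz : ∀ c : Fin l → R, ∑ i, f i * c i = 0 →
      ∃ b : Fin k → R, ∀ i, c i = ∑ j, s j i * b j := by
    intro c hc
    have : c ∈ Submodule.span R (Set.range s) := by
      rw [hs, LinearMap.mem_ker, hL, hc]
    obtain ⟨b, hb⟩ := (Submodule.mem_span_range_iff_exists_fun R).1 this
    refine ⟨b, fun i => ?_⟩
    rw [← hb]
    simp [mul_comm]
  refine ⟨k, fun i j => s j i, fun j => ?_, hsyz, ?_⟩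
  · have : s j ∈ LinearMap.ker L := hs ▸ Submodule.subset_span ⟨j, rfl⟩
    rwa [LinearMap.mem_ker, hL] at this
  · intro F _ _ _ x hx
    obtain ⟨n, a, y, hxy, ha⟩ := Module.Flat.isTrivialRelation_of_sum_smul_eq_zero hx
    choose b hb using fun j => hsyz (fun i => a i j) (ha j)
    refine ⟨fun j => ∑ m, b m j • y m, fun i => ?_⟩
    simp_rw [hxy, hb, Finset.sum_smul, Finset.smul_sum, smul_smul]
    exact Finset.sum_comm

/-- Flatness from relation matrices. -/
lemma flat_of_relation_matrix {F : Type u} [AddCommGroup F] [Module R F]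
    (h : ∀ {l : ℕ} (f : Fin l → R), ∃ (k : ℕ) (a : Fin l → Fin k → R),
      (∀ j, ∑ i, f i * a i j = 0) ∧ ∀ x : Fin l → F, ∑ i, f i • x i = 0 →
        ∃ y : Fin k → F, ∀ i, x i = ∑ j, a i j • y j) : Module.Flat R F :=
  Module.Flat.of_forall_isTrivialRelation fun {l f x} hx => by
    obtain ⟨k, a, ha, h'⟩ := h f
    obtain ⟨y, hy⟩ := h' x hx
    exact ⟨k, a, y, hy, ha⟩

lemma characterModule_sum_apply {E : Type u} [AddCommGroup E] {ι : Type*} (s : Finset ι)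
    (φ : ι → CharacterModule E) (e : E) : (∑ i ∈ s, φ i) e = ∑ i ∈ s, φ i e :=
  AddMonoidHom.finsetSum_apply φ s e

/-- The character module of an injective module over a noetherian ring is flat. -/
lemma flat_characterModule [IsNoetherianRing R] (E : Type u) [AddCommGroup E] [Module R E]
    (hE : Module.Injective R E) : Module.Flat R (CharacterModule E) := by
  refine flat_of_relation_matrix fun {l} f => ?_
  obtain ⟨k, a, ha, hsyz, -⟩ := exists_relation_matrix f
  refine ⟨k, a, ha, fun φ hφ => ?_⟩
  let g : (Fin l → E) →ₗ[R] (Fin k → E) :=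
    LinearMap.pi fun j => ∑ i, a i j • LinearMap.proj i
  have hg : ∀ u j, g u j = ∑ i, a i j • u i := fun u j => by simp [g]
  have hker : ∀ u, g u = 0 → ∃ e : E, ∀ i, u i = f i • e := by
    intro u hu
    let L : (Fin l → R) →ₗ[R] R := Fintype.linearCombination R f
    have hL : ∀ c, L c = ∑ i, f i * c i := fun c => by
      simp [L, Fintype.linearCombination_apply, mul_comm]
    let U : (Fin l → R) →ₗ[R] E := Fintype.linearCombination R u
    have hU : ∀ c, U c = ∑ i, c i • u i := fun c => by
      simp [U, Fintype.linearCombination_apply]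
    have hle : LinearMap.ker L ≤ LinearMap.ker U := by
      intro c hc
      rw [LinearMap.mem_ker, hL] at hc
      obtain ⟨b, hb⟩ := hsyz c hc
      rw [LinearMap.mem_ker, hU]
      simp_rw [hb, Finset.sum_smul]
      rw [Finset.sum_comm]
      refine Finset.sum_eq_zero fun j _ => ?_
      have := congrFun hu j
      rw [hg] at this
      simp_rw [mul_comm _ (b j), mul_smul]
      rw [← Finset.smul_sum, this, Pi.zero_apply, smul_zero]
    let T : LinearMap.range L →ₗ[R] E :=
      (LinearMap.ker L).liftQ U hle ∘ₗ (L.quotKerEquivRange).symm.toLinearMap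
    have hT : ∀ c, T ⟨L c, c, rfl⟩ = U c := fun c => by
      have : L.quotKerEquivRange.symm ⟨L c, c, rfl⟩ = Submodule.Quotient.mk c := by
        rw [LinearEquiv.symm_apply_eq]; rfl
      simp only [T, LinearMap.comp_apply, LinearEquiv.coe_coe, this]
      rfl
    obtain ⟨T', hT'⟩ := Module.Baer.of_injective hE (LinearMap.range L) T
    refine ⟨T' 1, fun i => ?_⟩
    have h1 : L (Pi.single i 1) = f i := by
      simp [L]
    have h2 : U (Pi.single i 1) = u i := by
      simp [U]
    rw [← map_smul, smul_eq_mul, mul_one, ← h1, hT' _ ⟨_, rfl⟩, hT, h2]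
  let Φ : CharacterModule (Fin l → E) :=
    ∑ i, CharacterModule.dual (LinearMap.proj i : (Fin l → E) →ₗ[R] E) (φ i)
  have hΦ : ∀ u, Φ u = ∑ i, φ i (u i) := fun u => by
    rw [characterModule_sum_apply]
    rfl
  obtain ⟨Ψ, hΨ⟩ := exists_character_factor g Φ (by
    intro u hu
    obtain ⟨e, he⟩ := hker u hu
    rw [hΦ]
    have h1 := DFunLike.congr_fun hφ e
    have h2 : (∑ i, f i • φ i : CharacterModule E) e = ∑ i, φ i (f i • e) := by
      rw [characterModule_sum_apply]
      rfl
    simp_rw [he]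
    exact h2.symm.trans h1)
  refine ⟨fun j => CharacterModule.dual (LinearMap.single R (fun _ => E) j) Ψ, fun i => ?_⟩
  ext e
  have h1 := hΨ (Pi.single i e)
  rw [hΦ, Finset.sum_eq_single i (by
    intro b _ hb; rw [Pi.single_eq_of_ne hb, map_zero]) (by simp), Pi.single_eq_same] at h1
  have h3 : (∑ j, a i j • CharacterModule.dual (LinearMap.single R (fun _ => E) j) Ψ :
      CharacterModule E) e = ∑ j, Ψ (Pi.single j (a i j • e)) := by
    rw [characterModule_sum_apply]
    rfl
  refine h1.symm.trans (Eq.trans ?_ h3.symm)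
  rw [← map_sum]
  congr 1
  funext j
  rw [hg, Finset.sum_apply, Finset.sum_eq_single i (by
    intro b _ hb; rw [Pi.single_eq_of_ne hb, smul_zero]) (by simp), Pi.single_eq_same,
    Finset.sum_eq_single j (by intro b _ hb; rw [Pi.single_eq_of_ne hb.symm]) (by simp),
    Pi.single_eq_same]

end Relations

end GFlat

namespace GFlat

open CategoryTheory Abelian IsLocalRing

variable {R : Type u} [CommRing R]

section Constructions

variable {A B C D F X : Type u} [AddCommGroup A] [Module R A] [AddCommGroup B] [Module R B]
    [AddCommGroup C] [Module R C] [AddCommGroup D] [Module R D] [AddCommGroup F] [Module R F]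
    [AddCommGroup X] [Module R X]

/-- The trivial short exact sequence `0 → A → A → 0 → 0`. -/
noncomputable def SES.idLeft (A : Type u) [AddCommGroup A] [Module R A] :
    SES R A A PUnit.{u + 1} where
  f := LinearMap.id
  g := 0
  inj := Function.injective_id
  surj := fun _ => ⟨0, rfl⟩
  exact := fun b => by simp

/-- Pushout of two short exact sequences with the same left term. -/
lemma exists_pushout (S : SES R A B C) (T : SES R A F D) :
    ∃ W : ModuleCat.{u} R, Nonempty (SES R F W C) ∧ Nonempty (SES R B W D) := by
  let U : Submodule R (B × F) := LinearMap.range (S.f.prod (-T.f))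
  have hU : ∀ b x, (b, x) ∈ U ↔ ∃ a, S.f a = b ∧ T.f a = -x := by
    intro b x
    constructor
    · rintro ⟨a, ha⟩
      have h1 := congrArg Prod.fst ha
      have h2 : (-T.f) a = x := congrArg Prod.snd ha
      exact ⟨a, h1, by rw [← h2]; simp⟩
    · rintro ⟨a, h1, h2⟩
      exact ⟨a, Prod.ext h1 (by simp [h2])⟩
  refine ⟨ModuleCat.of R ((B × F) ⧸ U), ⟨?_⟩, ⟨?_⟩⟩
  · refine
      { f := U.mkQ ∘ₗ LinearMap.inr R B F
        g := U.liftQ (S.g ∘ₗ LinearMap.fst R B F) ?_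
        inj := ?_
        surj := ?_
        exact := ?_ }
    · rintro ⟨b, x⟩ hx
      obtain ⟨a, rfl, -⟩ := (hU b x).1 hx
      exact S.gf a
    · rw [injective_iff_map_eq_zero]
      intro x hx
      have hx' : ((0 : B), x) ∈ U := (Submodule.Quotient.mk_eq_zero U).1 hx
      obtain ⟨a, h1, h2⟩ := (hU _ _).1 hx'
      rw [S.inj (h1.trans (map_zero S.f).symm), map_zero] at h2
      exact neg_eq_zero.1 h2.symm
    · intro c
      obtain ⟨b, rfl⟩ := S.surj c
      exact ⟨U.mkQ (b, 0), rfl⟩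
    · intro w
      obtain ⟨⟨b, x⟩, rfl⟩ := U.mkQ_surjective w
      constructor
      · intro h
        obtain ⟨a, rfl⟩ := S.lift (show S.g b = 0 from h)
        refine ⟨x + T.f a, (Submodule.Quotient.eq U).2 ?_⟩
        rw [LinearMap.inr_apply, Prod.mk_sub_mk, hU]
        exact ⟨-a, by simp, by simp⟩
      · rintro ⟨y, hy⟩
        rw [← hy]
        exact map_zero S.g
  · refine
      { f := U.mkQ ∘ₗ LinearMap.inl R B F
        g := U.liftQ (T.g ∘ₗ LinearMap.snd R B F) ?_
        inj := ?_
        surj := ?_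
        exact := ?_ }
    · rintro ⟨b, x⟩ hx
      obtain ⟨a, -, h⟩ := (hU b x).1 hx
      have : x = T.f (-a) := by rw [map_neg, h, neg_neg]
      rw [this]
      exact T.gf _
    · rw [injective_iff_map_eq_zero]
      intro x hx
      have hx' : (x, (0 : F)) ∈ U := (Submodule.Quotient.mk_eq_zero U).1 hx
      obtain ⟨a, h1, h2⟩ := (hU _ _).1 hx'
      rw [neg_zero] at h2
      rw [← h1, T.inj (h2.trans (map_zero T.f).symm), map_zero]
    · intro c
      obtain ⟨b, rfl⟩ := T.surj c
      exact ⟨U.mkQ (0, b), rfl⟩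
    · intro w
      obtain ⟨⟨b, x⟩, rfl⟩ := U.mkQ_surjective w
      constructor
      · intro h
        obtain ⟨a, rfl⟩ := T.lift (show T.g x = 0 from h)
        refine ⟨b + S.f a, (Submodule.Quotient.eq U).2 ?_⟩
        rw [LinearMap.inl_apply, Prod.mk_sub_mk, hU]
        exact ⟨a, by simp, by simp⟩
      · rintro ⟨y, hy⟩
        rw [← hy]
        exact map_zero T.g

variable (R A B) in
/-- The split short exact sequence `0 → A → A × B → B → 0`. -/
noncomputable def SES.prod : SES R A (A × B) B where
  f := LinearMap.inl R A B
  g := LinearMap.snd R A B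
  inj := LinearMap.inl_injective
  surj := LinearMap.snd_surjective
  exact := Function.Exact.inl_snd

lemma flat_prod (hA : Module.Flat R A) (hB : Module.Flat R B) : Module.Flat R (A × B) :=
  flat_mid (SES.prod R A B)

/-- A horseshoe embedding of an extension. -/
lemma exists_horseshoe {G D' : Type u} [AddCommGroup G] [Module R G] [AddCommGroup D'] [Module R D']
    (S : SES R A X C) (T : SES R A F D) (T' : SES R C G D') (h : X →ₗ[R] F)
    (hh : h ∘ₗ S.f = T.f) :
    ∃ W : ModuleCat.{u} R, Nonempty (SES R X (F × G) W) ∧ Nonempty (SES R D W D') := by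
  have hh' : ∀ a, h (S.f a) = T.f a := fun a => DFunLike.congr_fun hh a
  let i : X →ₗ[R] F × G := h.prod (T'.f ∘ₗ S.g)
  have hi : Function.Injective i := by
    rw [injective_iff_map_eq_zero]
    intro x hx
    have h1 : h x = 0 := congrArg Prod.fst hx
    have h2 : T'.f (S.g x) = 0 := congrArg Prod.snd hx
    obtain ⟨a, rfl⟩ := S.lift (T'.inj (h2.trans (map_zero _).symm))
    rw [hh'] at h1
    rw [T.inj (h1.trans (map_zero _).symm), map_zero]
  let U := LinearMap.range i
  let j : F →ₗ[R] (F × G) ⧸ U := U.mkQ ∘ₗ LinearMap.inl R F G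
  have hj : ∀ y, j y = 0 ↔ T.g y = 0 := by
    intro y
    constructor
    · intro hy
      obtain ⟨x, hx⟩ := (Submodule.Quotient.mk_eq_zero U).1 hy
      have h1 : h x = y := congrArg Prod.fst hx
      have h2 : T'.f (S.g x) = 0 := congrArg Prod.snd hx
      obtain ⟨a, rfl⟩ := S.lift (T'.inj (h2.trans (map_zero _).symm))
      rw [← h1, hh', T.gf]
    · intro hy
      obtain ⟨a, rfl⟩ := T.lift hy
      refine (Submodule.Quotient.mk_eq_zero U).2 ⟨S.f a, Prod.ext (hh' a) ?_⟩
      change T'.f (S.g (S.f a)) = 0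
      rw [S.gf, map_zero]
  let e : (F ⧸ LinearMap.ker T.g) ≃ₗ[R] D := T.g.quotKerEquivOfSurjective T.surj
  let k : (F ⧸ LinearMap.ker T.g) →ₗ[R] (F × G) ⧸ U :=
    (LinearMap.ker T.g).liftQ j fun y hy => (hj y).2 hy
  have hk : ∀ y, (k ∘ₗ e.symm.toLinearMap) (T.g y) = j y := by
    intro y
    have : e.symm (T.g y) = Submodule.Quotient.mk y := by
      rw [LinearEquiv.symm_apply_eq]; rfl
    simp only [LinearMap.comp_apply, LinearEquiv.coe_coe, this]
    rfl
  refine ⟨ModuleCat.of R ((F × G) ⧸ U), ⟨SES.ofInj i hi⟩, ⟨?_⟩⟩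
  refine
    { f := k ∘ₗ e.symm.toLinearMap
      g := U.liftQ (T'.g ∘ₗ LinearMap.snd R F G) ?_
      inj := ?_
      surj := ?_
      exact := ?_ }
  · rintro _ ⟨x, rfl⟩
    exact T'.gf _
  · rw [injective_iff_map_eq_zero]
    intro d hd
    obtain ⟨y, rfl⟩ := T.surj d
    rw [hk] at hd
    exact (hj y).1 hd
  · intro c
    obtain ⟨b, rfl⟩ := T'.surj c
    exact ⟨U.mkQ (0, b), rfl⟩
  · intro w
    obtain ⟨⟨y, z⟩, rfl⟩ := U.mkQ_surjective w
    constructor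
    · intro hw
      obtain ⟨c, rfl⟩ := T'.lift (show T'.g z = 0 from hw)
      obtain ⟨x, rfl⟩ := S.surj c
      refine ⟨T.g (y - h x), ?_⟩
      rw [hk]
      refine (Submodule.Quotient.eq U).2 ⟨-x, ?_⟩
      refine Prod.ext ?_ ?_
      · change h (-x) = y - h x - y
        rw [map_neg]; abel
      · change T'.f (S.g (-x)) = 0 - T'.f (S.g x)
        rw [map_neg, map_neg, zero_sub]
    · rintro ⟨d, hd⟩
      obtain ⟨y', rfl⟩ := T.surj d
      rw [hk] at hd
      rw [← hd]
      exact map_zero T'.g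

/-- Flip a linear map into a character module. -/
noncomputable def flipChar (ψ : A →ₗ[R] CharacterModule B) : B →ₗ[R] CharacterModule A where
  toFun b :=
    { toFun := fun a => ψ a b
      map_zero' := by rw [map_zero]; rfl
      map_add' := fun a a' => by rw [map_add]; rfl }
  map_add' b b' := by
    ext a
    exact map_add (ψ a) b b'
  map_smul' r b := by
    ext a
    change ψ a (r • b) = ψ (r • a) b
    exact (DFunLike.congr_fun (ψ.map_smul r a) b).symm

/-- A flat module over a noetherian ring embeds with flat cokernel in its flat double dual, through
which maps extend along extensions by modules with vanishing first `Tor` against injectives. -/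
lemma exists_extension_double_dual [IsNoetherianRing R] [Module.Flat R F] (S : SES R A X C)
    (hC : ∀ E : ModuleCat.{u} R, Module.Injective R E → TV R 1 E C) (f : A →ₗ[R] F) :
    ∃ (F' L : ModuleCat.{u} R) (T : SES R F F' L) (h : X →ₗ[R] F'), Module.Flat R F' ∧
      Module.Flat R L ∧ h ∘ₗ S.f = T.f ∘ₗ f := by
  have hE := (Module.Flat.iff_characterModule_injective (R := R) (M := F)).1 inferInstance
  have hF' := flat_characterModule (R := R) _ hE
  let ev : F →ₗ[R] CharacterModule (CharacterModule F) := flipChar LinearMap.id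
  have hev : Function.Injective ev := by
    rw [injective_iff_map_eq_zero]
    intro x hx
    exact CharacterModule.eq_zero_of_character_apply fun c => DFunLike.congr_fun hx c
  let T := SES.ofInj ev hev
  obtain ⟨ψ, hψ⟩ := ExtZ.exists_lift S.dual (hC (ModuleCat.of R (CharacterModule F)) hE)
    (CharacterModule.dual f)
  refine ⟨ModuleCat.of R (CharacterModule (CharacterModule F)), ModuleCat.of R _, T,
    flipChar ψ, hF', ?_, ?_⟩
  · refine flat_of_tv fun I => ?_
    refine extZ_one_of_exists_lift T.dual (tv_of_flat 0) fun φ =>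
      ⟨flipChar LinearMap.id ∘ₗ φ, ?_⟩
    ext n
    rfl
  · ext a e
    exact DFunLike.congr_fun (DFunLike.congr_fun hψ e) a

end Constructions

section GF

variable (R) in
/-- `A` has vanishing positive `Tor` against injective modules. -/
def InjAcyclic (A : Type u) [AddCommGroup A] [Module R A] : Prop :=
  ∀ E : ModuleCat.{u} R, Module.Injective R E → ∀ i, TV R (i + 1) E A

variable (R) in
/-- The largest class of modules acyclic against injectives in which every module embeds in a flat
module with cokernel in the class; this is the class of Gorenstein flat modules. -/
def GF (A : Type u) [AddCommGroup A] [Module R A] : Prop :=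
  ∃ P : ModuleCat.{u} R → Prop, P (ModuleCat.of R A) ∧ ∀ B, P B → InjAcyclic R B ∧
    ∃ F C : ModuleCat.{u} R, Module.Flat R F ∧ Nonempty (SES R B F C) ∧ P C

variable {A B C : Type u} [AddCommGroup A] [Module R A] [AddCommGroup B] [Module R B]
    [AddCommGroup C] [Module R C]

lemma GF.injAcyclic (h : GF R A) : InjAcyclic R A := by
  obtain ⟨P, hA, hP⟩ := h
  exact (hP _ hA).1

lemma GF.exists_embedding (h : GF R A) :
    ∃ F C : ModuleCat.{u} R, Module.Flat R F ∧ Nonempty (SES R A F C) ∧ GF R C := by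
  obtain ⟨P, hA, hP⟩ := h
  obtain ⟨-, F, C, hF, S, hC⟩ := hP _ hA
  exact ⟨F, C, hF, S, P, hC, hP⟩

lemma GF.of_embedding {F : Type u} [AddCommGroup F] [Module R F] [Module.Flat R F]
    (h : InjAcyclic R A) (S : SES R A F C) (hC : GF R C) : GF R A := by
  refine ⟨fun X => GF R X ∨ (InjAcyclic R X ∧ ∃ F C : ModuleCat.{u} R, Module.Flat R F ∧
    Nonempty (SES R X F C) ∧ GF R C), Or.inr ⟨h, ModuleCat.of R F, ModuleCat.of R C,
      inferInstanceAs (Module.Flat R F), ⟨S⟩, hC⟩, ?_⟩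
  rintro X (hX | ⟨hX, F, C, hF, S, hC⟩)
  · obtain ⟨F, C, hF, S, hC⟩ := hX.exists_embedding
    exact ⟨hX.injAcyclic, F, C, hF, S, Or.inl hC⟩
  · exact ⟨hX, F, C, hF, S, Or.inl hC⟩

lemma injAcyclic_of_flat [Module.Flat R A] : InjAcyclic R A := fun _ _ i => tv_of_flat i

lemma gf_of_flat [Module.Flat R A] : GF R A := by
  refine ⟨fun X => Module.Flat R X, inferInstanceAs (Module.Flat R A), fun X hX =>
    ⟨injAcyclic_of_flat, X, ModuleCat.of R PUnit.{u + 1}, hX, ⟨SES.idLeft X⟩,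
      inferInstanceAs (Module.Flat R PUnit.{u + 1})⟩⟩

lemma InjAcyclic.congr (h : InjAcyclic R A) (e : A ≃ₗ[R] B) : InjAcyclic R B :=
  fun E hE i => (h E hE i).congr e

/-- The kernel of a map from a flat module onto a Gorenstein flat module is Gorenstein flat. -/
lemma GF.ker (S : SES R A B C) [Module.Flat R B] (hC : GF R C) : GF R A :=
  GF.of_embedding (fun E hE i => TV.left S (tv_of_flat i) (hC.injAcyclic E hE (i + 1))) S hC

lemma InjAcyclic.mid (S : SES R A B C) (hA : InjAcyclic R A) (hC : InjAcyclic R C) :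
    InjAcyclic R B := fun E hE i => TV.mid S (hA E hE i) (hC E hE i)

lemma GF.mid_flat (S : SES R A B C) (hA : GF R A) [Module.Flat R C] : GF R B := by
  obtain ⟨F, C', hF, ⟨T⟩, hC'⟩ := hA.exists_embedding
  obtain ⟨W, ⟨U⟩, ⟨V⟩⟩ := exists_pushout S T
  have := flat_mid U
  exact GF.of_embedding (hA.injAcyclic.mid S injAcyclic_of_flat) V hC'

/-- Gorenstein flat modules over a noetherian ring are closed under extensions. -/
lemma GF.mid [IsNoetherianRing R] (S : SES R A B C) (hA : GF R A) (hC : GF R C) : GF R B := by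
  refine ⟨fun X => ∃ A C : ModuleCat.{u} R, GF R A ∧ GF R C ∧ Nonempty (SES R A X C),
    ⟨ModuleCat.of R A, ModuleCat.of R C, hA, hC, ⟨S⟩⟩, ?_⟩
  rintro X ⟨A, C, hA, hC, ⟨S⟩⟩
  refine ⟨hA.injAcyclic.mid S hC.injAcyclic, ?_⟩
  obtain ⟨F, A', hF, ⟨T⟩, hA'⟩ := hA.exists_embedding
  obtain ⟨G, C', hG, ⟨T'⟩, hC'⟩ := hC.exists_embedding
  obtain ⟨F', L, U, h, hF', hL, hh⟩ :=
    exists_extension_double_dual S (fun E hE => hC.injAcyclic E hE 0) T.f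
  let V := SES.ofInj (U.f ∘ₗ T.f) (U.inj.comp T.inj)
  have hD : GF R (F' ⧸ LinearMap.range (U.f ∘ₗ T.f)) := by
    obtain ⟨k, hk⟩ : ∃ k : A' →ₗ[R] (F' ⧸ LinearMap.range (U.f ∘ₗ T.f)), ∀ x,
        k (T.g x) = V.g (U.f x) := by
      let e : (F ⧸ LinearMap.ker T.g) ≃ₗ[R] A' := T.g.quotKerEquivOfSurjective T.surj
      refine ⟨(LinearMap.ker T.g).liftQ (V.g ∘ₗ U.f) ?_ ∘ₗ e.symm.toLinearMap, fun x => ?_⟩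
      · intro y hy
        obtain ⟨a, rfl⟩ := T.lift hy
        exact V.gf a
      · have : e.symm (T.g x) = Submodule.Quotient.mk x := by
          rw [LinearEquiv.symm_apply_eq]; rfl
        simp only [LinearMap.comp_apply, LinearEquiv.coe_coe, this]
        rfl
    let Q : SES R A' (F' ⧸ LinearMap.range (U.f ∘ₗ T.f)) L :=
      { f := k
        g := (LinearMap.range (U.f ∘ₗ T.f)).liftQ U.g (by
          rintro _ ⟨a, rfl⟩
          exact U.gf _)
        inj := by
          rw [injective_iff_map_eq_zero]
          intro y hy
          obtain ⟨x, rfl⟩ := T.surj y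
          rw [hk] at hy
          obtain ⟨a, ha⟩ := V.lift hy
          rw [← U.inj ha, T.gf]
        surj := fun l => by
          obtain ⟨y, rfl⟩ := U.surj l
          exact ⟨V.g y, rfl⟩
        exact := fun w => by
          obtain ⟨y, rfl⟩ := V.surj w
          constructor
          · intro hy
            obtain ⟨x, rfl⟩ := U.lift (show U.g y = 0 from hy)
            exact ⟨T.g x, hk x⟩
          · rintro ⟨z, hz⟩
            obtain ⟨x, rfl⟩ := T.surj z
            rw [← hz, hk]
            exact U.gf x }
    exact GF.mid_flat Q hA'
  obtain ⟨W, ⟨W1⟩, ⟨W2⟩⟩ := exists_horseshoe S V T' h hh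
  exact ⟨ModuleCat.of R (F' × G), W, flat_prod hF' hG, ⟨W1⟩,
    ModuleCat.of R _, C', hD, hC', ⟨W2⟩⟩

end GF

end GFlat

namespace GFlat

open CategoryTheory Abelian IsLocalRing

variable {R : Type u} [CommRing R]

attribute [local instance] GorensteinFlatWitness.instAdd GorensteinFlatWitness.instMod

section Witness

variable {Q : Type u} [AddCommGroup Q] [Module R Q]

/-- The short exact sequence cut out of an exact complex at one spot. -/
noncomputable def _root_.GorensteinFlatWitness.ses (w : GorensteinFlatWitness R Q) (i : ℤ) :
    SES R (LinearMap.range (w.d (i + 1))) (w.F (i + 1)) (LinearMap.range (w.d i)) where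
  f := Submodule.subtype _
  g := (w.d i).rangeRestrict
  inj := Subtype.val_injective
  surj := LinearMap.surjective_rangeRestrict _
  exact := fun b => by
    rw [Subtype.ext_iff]
    refine (w.exact i b).trans ?_
    constructor
    · rintro ⟨a, ha⟩
      exact ⟨⟨b, a, ha⟩, rfl⟩
    · rintro ⟨⟨_, a, rfl⟩, rfl⟩
      exact ⟨a, rfl⟩

lemma _root_.GorensteinFlatWitness.tv_range (w : GorensteinFlatWitness R Q) (E : ModuleCat.{u} R)
    (hE : Module.Injective R E) (j : ℕ) : ∀ i : ℤ, TV R (j + 1) E (LinearMap.range (w.d i)) := by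
  induction j with
  | zero =>
    intro i
    have := w.flat (i + 1)
    refine tv_one_of_lTensor_injective (w.ses i) (tv_of_flat 0) ?_
    rw [injective_iff_map_eq_zero]
    intro t ht
    obtain ⟨v, rfl⟩ := LinearMap.lTensor_surjective E
      (LinearMap.surjective_rangeRestrict (w.d (i + 1))) t
    have hc : (w.ses i).f ∘ₗ (w.d (i + 1)).rangeRestrict = w.d (i + 1) := rfl
    rw [← LinearMap.comp_apply, ← LinearMap.lTensor_comp, hc] at ht
    obtain ⟨v', rfl⟩ := (w.exact_tensor E hE (i + 1) v).1 ht
    rw [← LinearMap.comp_apply, ← LinearMap.lTensor_comp]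
    have h0 : (w.d (i + 1)).rangeRestrict ∘ₗ w.d (i + 1 + 1) = 0 := by
      ext x
      exact (w.exact (i + 1)).apply_apply_eq_zero x
    rw [h0, LinearMap.lTensor_zero, LinearMap.zero_apply]
  | succ j ih =>
    intro i
    have := w.flat (i + 1)
    exact TV.right (w.ses i) (ih (i + 1)) (tv_of_flat _)

lemma _root_.IsGorensteinFlat.gf (h : IsGorensteinFlat R Q) : GF R Q := by
  obtain ⟨w⟩ := h
  refine ⟨fun B => ∃ i : ℤ, Nonempty (B ≃ₗ[R] LinearMap.range (w.d i)), ⟨0, w.iso⟩, ?_⟩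
  rintro B ⟨i, ⟨e⟩⟩
  obtain ⟨k, rfl⟩ : ∃ k : ℤ, i = k + 1 := ⟨i - 1, by ring⟩
  exact ⟨fun E hE j => (w.tv_range E hE j (k + 1)).congr e.symm, ModuleCat.of R (w.F (k + 1)),
    ModuleCat.of R (LinearMap.range (w.d k)), w.flat _, ⟨(w.ses k).congrLeft e⟩, k,
    ⟨LinearEquiv.refl _ _⟩⟩

/-- Splicing two composable exact pairs. -/
lemma exact_splice {A B C D : Type*} {P : Type*} [AddCommGroup A] [Module R A] [AddCommGroup B]
    [Module R B] [AddCommGroup C] [Module R C] [AddCommGroup D] [Module R D] [AddCommGroup P]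
    [Module R P] {p : P →ₗ[R] A} {f : A →ₗ[R] B} {g : B →ₗ[R] C} {q : C →ₗ[R] D}
    (h : Function.Exact f g) (hp : Function.Surjective p) (hq : Function.Injective q) :
    Function.Exact (f ∘ₗ p) (q ∘ₗ g) := by
  intro b
  have : (q ∘ₗ g) b = 0 ↔ g b = 0 := by
    rw [LinearMap.comp_apply, ← map_zero q]
    exact hq.eq_iff
  rw [this, h b]
  constructor
  · rintro ⟨a, rfl⟩
    obtain ⟨x, rfl⟩ := hp a
    exact ⟨x, rfl⟩
  · rintro ⟨x, rfl⟩
    exact ⟨p x, rfl⟩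

/-- A relation which is total on both sides admits bi-infinite chains through every point. -/
lemma exists_int_chain {α : Type*} (r : α → α → Prop) (hl : ∀ a, ∃ b, r b a)
    (hr : ∀ a, ∃ b, r a b) (a : α) : ∃ z : ℤ → α, z 1 = a ∧ ∀ i, r (z (i + 1)) (z i) := by
  choose L hL using hl
  choose D hD using hr
  let w : ℤ → α := fun i => match i with
    | Int.ofNat n => L^[n] a
    | Int.negSucc n => D^[n + 1] a
  have hw : ∀ i, r (w (i + 1)) (w i) := by
    rintro (n | n | n)
    · change r (L^[n + 1] a) (L^[n] a)
      rw [Function.iterate_succ_apply']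
      exact hL _
    · exact hD a
    · change r (D^[n + 1] a) (D^[n + 1 + 1] a)
      rw [Function.iterate_succ_apply' D (n + 1)]
      exact hD _
  refine ⟨fun i => w (i - 1), rfl, fun i => ?_⟩
  have := hw (i - 1)
  rwa [show i - 1 + 1 = i + 1 - 1 by ring] at this

lemma GF.isGorensteinFlat (h : GF R Q) : IsGorensteinFlat R Q := by
  obtain ⟨z, hz, hr⟩ := exists_int_chain (α := {A : ModuleCat.{u} R // GF R A})
    (fun A B => ∃ G : ModuleCat.{u} R, Module.Flat R G ∧ Nonempty (SES R A.1 G B.1))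
    (fun A => by
      obtain ⟨G, hG, π, hπ⟩ := exists_free_cover (R := R) A.1
      exact ⟨⟨ModuleCat.of R (LinearMap.ker π), GF.ker (SES.ofSurj π hπ) A.2⟩,
        G, inferInstance, ⟨SES.ofSurj π hπ⟩⟩)
    (fun A => by
      obtain ⟨F, C, hF, S, hC⟩ := A.2.exists_embedding
      exact ⟨⟨C, hC⟩, F, hF, S⟩) ⟨ModuleCat.of R Q, h⟩
  choose G hG S using hr
  replace S := fun i => (S i).some
  have e : Q ≃ₗ[R] (z (0 + 1)).1 := by
    have h1 : (z (0 + 1)).1 = ModuleCat.of R Q := by rw [zero_add, hz]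
    exact (eqToIso h1.symm).toLinearEquiv
  refine ⟨{
    F := fun i => G i
    d := fun i => (S i).f ∘ₗ (S (i + 1)).g
    flat := hG
    exact := fun i => exact_splice (S (i + 1)).exact (S (i + 1 + 1)).surj (S i).inj
    exact_tensor := ?_
    iso := ?_ }⟩
  · intro I _ _ hI i
    rw [LinearMap.lTensor_comp, LinearMap.lTensor_comp]
    exact exact_splice (lTensor_exact I (S (i + 1)).exact (S (i + 1)).surj)
      (LinearMap.lTensor_surjective I (S (i + 1 + 1)).surj)
      (TV.lTensor_injective (S i) ((z i).2.injAcyclic (ModuleCat.of R I) hI 0))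
  · have h1 : LinearMap.range ((S 0).f ∘ₗ (S (0 + 1)).g) = LinearMap.range (S 0).f :=
      LinearMap.range_comp_of_range_eq_top _ (LinearMap.range_eq_top.2 (S (0 + 1)).surj)
    exact ⟨e.trans ((LinearEquiv.ofInjective (S 0).f (S 0).inj).trans (LinearEquiv.ofEq _ _ h1.symm))⟩

end Witness

section GD

variable (R) in
/-- `M` embeds in a module of flat dimension at most `n` with Gorenstein flat cokernel. -/
def GD (n : ℕ) (M : Type u) [AddCommGroup M] [Module R M] : Prop :=
  ∃ H A : ModuleCat.{u} R, Nonempty (SES R M H A) ∧ FD R n H ∧ GF R A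

lemma GD.of_ses {n : ℕ} {M H A : Type u} [AddCommGroup M] [Module R M] [AddCommGroup H]
    [Module R H] [AddCommGroup A] [Module R A] (S : SES R M H A) (hH : FD R n H) (hA : GF R A) :
    GD R n M := ⟨ModuleCat.of R H, ModuleCat.of R A, ⟨S⟩, hH, hA⟩

lemma gd_of_fd {n : ℕ} {M : Type u} [AddCommGroup M] [Module R M] (h : FD R n M) : GD R n M :=
  GD.of_ses (SES.idLeft M) h gf_of_flat

/-- The third isomorphism theorem for a flag `H ⊆ P ⊆ F`. -/
lemma exists_quotient_ses {H P M F C : Type u} [AddCommGroup H] [Module R H] [AddCommGroup P]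
    [Module R P] [AddCommGroup M] [Module R M] [AddCommGroup F] [Module R F] [AddCommGroup C]
    [Module R C] (U : SES R H P M) (V : SES R P F C) :
    ∃ W : ModuleCat.{u} R, Nonempty (SES R H F W) ∧ Nonempty (SES R M W C) := by
  let j : H →ₗ[R] F := V.f ∘ₗ U.f
  let T := SES.ofInj j (V.inj.comp U.inj)
  let e : (P ⧸ LinearMap.ker U.g) ≃ₗ[R] M := U.g.quotKerEquivOfSurjective U.surj
  let k : M →ₗ[R] F ⧸ LinearMap.range j := (LinearMap.ker U.g).liftQ (T.g ∘ₗ V.f) (by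
    intro y hy
    obtain ⟨a, rfl⟩ := U.lift hy
    exact T.gf a) ∘ₗ e.symm.toLinearMap
  have hk : ∀ x, k (U.g x) = T.g (V.f x) := fun x => by
    have : e.symm (U.g x) = Submodule.Quotient.mk x := by
      rw [LinearEquiv.symm_apply_eq]; rfl
    simp only [k, LinearMap.comp_apply, LinearEquiv.coe_coe, this]
    rfl
  refine ⟨ModuleCat.of R (F ⧸ LinearMap.range j), ⟨T⟩, ⟨?_⟩⟩
  exact
    { f := k
      g := (LinearMap.range j).liftQ V.g (by
        rintro _ ⟨a, rfl⟩
        exact V.gf _)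
      inj := by
        rw [injective_iff_map_eq_zero]
        intro y hy
        obtain ⟨x, rfl⟩ := U.surj y
        rw [hk] at hy
        obtain ⟨a, ha⟩ := T.lift hy
        rw [← V.inj ha, U.gf]
      surj := fun l => by
        obtain ⟨y, rfl⟩ := V.surj l
        exact ⟨T.g y, rfl⟩
      exact := fun w => by
        obtain ⟨y, rfl⟩ := T.surj w
        constructor
        · intro hy
          obtain ⟨x, rfl⟩ := V.lift (show V.g y = 0 from hy)
          exact ⟨U.g x, hk x⟩
        · rintro ⟨z, hz⟩
          obtain ⟨x, rfl⟩ := U.surj z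
          rw [← hz, hk]
          exact V.gf x }

/-- Pulling back a surjection `G → H` along `M ⊆ H`. -/
lemma exists_pullback_ses {K G H M A : Type u} [AddCommGroup K] [Module R K] [AddCommGroup G]
    [Module R G] [AddCommGroup M] [Module R M] [AddCommGroup H] [Module R H] [AddCommGroup A]
    [Module R A] (U : SES R K G H) (V : SES R M H A) :
    ∃ W : ModuleCat.{u} R, Nonempty (SES R K W M) ∧ Nonempty (SES R W G A) := by
  let q : G →ₗ[R] A := V.g ∘ₗ U.g
  let T := SES.ofSurj q (V.surj.comp U.surj)
  have hl : ∀ y : LinearMap.ker q, ∃ m, V.f m = U.g y := fun y => V.lift y.2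
  choose l hl using hl
  refine ⟨ModuleCat.of R (LinearMap.ker q), ⟨?_⟩, ⟨T⟩⟩
  exact
    { f := U.f.codRestrict _ (fun k => by
        change V.g (U.g (U.f k)) = 0
        rw [U.gf, map_zero])
      g :=
        { toFun := l
          map_add' := fun x y => V.inj (by rw [map_add, hl, hl, hl]; exact map_add U.g _ _)
          map_smul' := fun r x => V.inj (by
            rw [map_smul, hl, hl]; exact map_smul U.g _ _) }
      inj := fun a b h => U.inj (congrArg Subtype.val h)
      surj := fun m => by
        obtain ⟨g, hg⟩ := U.surj (V.f m)
        refine ⟨⟨g, ?_⟩, V.inj ?_⟩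
        · change V.g (U.g g) = 0
          rw [hg, V.gf]
        · exact (hl _).trans hg
      exact := fun w => by
        constructor
        · intro h
          have h' : l w = 0 := h
          have := hl w
          rw [h', map_zero] at this
          obtain ⟨k, hk⟩ := U.lift this.symm
          exact ⟨k, Subtype.ext hk⟩
        · rintro ⟨k, rfl⟩
          exact V.inj ((hl _).trans ((U.gf k).trans (map_zero V.f).symm)) }

lemma gd_of_gfdLE [IsNoetherianRing R] (n : ℕ) : ∀ (M : Type u) [AddCommGroup M] [Module R M],
    gfdLE R n M → GD R n M := by
  induction n with
  | zero =>
    intro M _ _ h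
    obtain ⟨F, C, hF, ⟨S⟩, hC⟩ := (IsGorensteinFlat.gf h).exists_embedding
    exact GD.of_ses S (fd_of_flat 0) hC
  | succ n ih =>
    rintro M _ _ ⟨c, hc⟩
    obtain ⟨H, A, ⟨S⟩, hH, hA⟩ := ih _ hc
    obtain ⟨P, ⟨U⟩, ⟨V⟩⟩ := exists_pushout (SES.ofSurj c.π c.surj) S
    obtain ⟨F, C, hF, ⟨T⟩, hC⟩ := (GF.mid V c.gflat.gf hA).exists_embedding
    obtain ⟨W, ⟨X⟩, ⟨Y⟩⟩ := exists_quotient_ses U T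
    exact GD.of_ses Y (FD.right X hH (fd_of_flat _)) hC

lemma gfdLE_of_gd (n : ℕ) : ∀ (M : Type u) [AddCommGroup M] [Module R M],
    GD R n M → gfdLE R n M := by
  induction n with
  | zero =>
    rintro M _ _ ⟨H, A, ⟨S⟩, hH, hA⟩
    have := hH.flat
    exact (GF.ker S hA).isGorensteinFlat
  | succ n ih =>
    rintro M _ _ ⟨H, A, ⟨S⟩, hH, hA⟩
    obtain ⟨G, hG, π, hπ⟩ := exists_free_cover (R := R) H
    obtain ⟨W, ⟨U⟩, ⟨V⟩⟩ := exists_pullback_ses (SES.ofSurj π hπ) S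
    have hK : FD R n (LinearMap.ker π) := FD.left (SES.ofSurj π hπ) (fd_of_flat n) hH
    refine ⟨⟨W, U.g, (GF.ker V hA).isGorensteinFlat, U.surj⟩, ih _ (gd_of_fd (hK.congr ?_))⟩
    have h1 : LinearMap.range U.f = LinearMap.ker U.g := U.exact.linearMap_ker_eq.symm
    exact (LinearEquiv.ofInjective U.f U.inj).trans (LinearEquiv.ofEq _ _ h1)

lemma gfdLE_iff_gd [IsNoetherianRing R] {n : ℕ} {M : Type u} [AddCommGroup M] [Module R M] :
    gfdLE R n M ↔ GD R n M := ⟨gd_of_gfdLE n M, gfdLE_of_gd n M⟩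

end GD

end GFlat

namespace GFlat

open CategoryTheory Abelian IsLocalRing

variable {R : Type u} [CommRing R]

/-- The short exact sequence `0 → R/(I : a) → R/I → R/(I + (a)) → 0`. -/
noncomputable def SES.colon {I K : Ideal R} (a : R) (hK : ∀ r, r ∈ K ↔ r * a ∈ I) :
    SES R (R ⧸ K) (R ⧸ I) (R ⧸ (I ⊔ Ideal.span {a})) where
  f := Submodule.mapQ K I (LinearMap.toSpanSingleton R R a) fun r hr => (hK r).1 hr
  g := Submodule.factor le_sup_left
  inj := by
    rw [injective_iff_map_eq_zero]
    intro x hx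
    obtain ⟨r, rfl⟩ := Submodule.mkQ_surjective _ x
    exact (Submodule.Quotient.mk_eq_zero _).2
      ((hK r).2 ((Submodule.Quotient.mk_eq_zero _).1 hx))
  surj := Submodule.factor_surjective _
  exact := fun x => by
    obtain ⟨r, rfl⟩ := Submodule.mkQ_surjective _ x
    constructor
    · intro h
      have h' : r ∈ I ⊔ Ideal.span {a} := (Submodule.Quotient.mk_eq_zero _).1 h
      obtain ⟨i, hi, j, hj, rfl⟩ := Submodule.mem_sup.1 h'
      obtain ⟨t, rfl⟩ := Ideal.mem_span_singleton'.1 hj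
      refine ⟨K.mkQ t, (Submodule.Quotient.eq I).2 ?_⟩
      have : t * a - (i + t * a) = -i := by ring
      change t * a - (i + t * a) ∈ I
      rw [this]
      exact I.neg_mem hi
    · rintro ⟨y, hy⟩
      obtain ⟨t, rfl⟩ := Submodule.mkQ_surjective _ y
      rw [← hy]
      exact (Submodule.Quotient.mk_eq_zero _).2
        (Ideal.mem_sup_right (Ideal.mem_span_singleton'.2 ⟨t, rfl⟩))

/-- If multiplication by `s` on `A` has a cokernel with vanishing `Ext` and `s` kills the `Ext` of
`A`, then that `Ext` vanishes. -/
lemma ExtKill.extZ_of_smul {A C V : Type u} [AddCommGroup A] [Module R A] [AddCommGroup C]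
    [Module R C] [AddCommGroup V] [Module R V] (S : SES R A A C) {s : R}
    (hS : S.f = s • LinearMap.id) {i : ℕ} (hA : ExtKill s i A V) (hC : ExtZ R i C V) :
    ExtZ R i A V := by
  refine extZ_of_forall fun e => ?_
  obtain ⟨e', he'⟩ := Abelian.Ext.contravariant_sequence_exact₂ S.shortExact (ModuleCat.of R V)
    e (by
      have : ModuleCat.ofHom S.f = s • 𝟙 (ModuleCat.of R A) := by rw [hS]; rfl
      change (Abelian.Ext.mk₀ (ModuleCat.ofHom S.f)).comp e (zero_add i) = 0
      rw [this, Abelian.Ext.mk₀_smul, Abelian.Ext.smul_comp, Abelian.Ext.mk₀_id_comp]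
      exact hA e)
  rw [← he', hC.eq_zero e', Abelian.Ext.comp_zero]

/-- Vanishing of a half exact contravariant functor on all cyclic modules follows from the prime
case, by noetherian induction. -/
lemma TV.of_prime [IsNoetherianRing R] {A : Type u} [AddCommGroup A] [Module R A] {i : ℕ}
    (h : ∀ p : Ideal R, p.IsPrime → ∃ s ∉ p, ExtKill s i (R ⧸ p) (CharacterModule A))
    (I : Ideal R) : TV R i (R ⧸ I) A := by
  induction I using WellFoundedGT.induction with
  | ind I ih =>
    by_cases htop : I = ⊤
    · subst htop
      refine extZ_of_forall fun e => ?_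
      have : 𝟙 (ModuleCat.of R (R ⧸ (⊤ : Ideal R))) = 0 := by
        ext
        exact Subsingleton.elim _ _
      rw [← Abelian.Ext.mk₀_id_comp e, this, Abelian.Ext.mk₀_zero, Abelian.Ext.zero_comp]
    by_cases hp : I.IsPrime
    · obtain ⟨s, hs, hk⟩ := h I hp
      refine hk.extZ_of_smul (SES.colon (I := I) (K := I) s fun r => ?_) ?_
        (ih _ (lt_of_le_of_ne le_sup_left fun hh => hs ?_))
      · constructor
        · exact fun hr => I.mul_mem_right s hr
        · exact fun hr => (hp.mem_or_mem hr).resolve_right hs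
      · ext
        change I.mkQ (1 * s) = s • I.mkQ 1
        rw [← map_smul, smul_eq_mul, mul_comm]
      · rw [hh]
        exact Ideal.mem_sup_right (Ideal.mem_span_singleton_self s)
    · rw [Ideal.isPrime_iff] at hp
      push Not at hp
      obtain ⟨a, b, hab, ha, hb⟩ := hp htop
      have S := SES.colon (I := I) (K := I.colon {b}) b fun r => by
        rw [Submodule.mem_colon_singleton, smul_eq_mul]
      refine TV.contra_mid S (ih _ (lt_of_le_of_ne ?_ ?_))
        (ih _ (lt_of_le_of_ne le_sup_left fun hh => hb ?_))
      · intro r hr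
        rw [Submodule.mem_colon_singleton]
        exact I.mul_mem_right b hr
      · intro hh
        refine ha ?_
        rw [hh, Submodule.mem_colon_singleton]
        exact hab
      · rw [hh]
        exact Ideal.mem_sup_right (Ideal.mem_span_singleton_self b)

/-- The saturation of an ideal at a prime. -/
def saturation (p : Ideal R) [hp : p.IsPrime] (I : Ideal R) : Ideal R where
  carrier := {r | ∃ s ∉ p, s * r ∈ I}
  add_mem' := by
    rintro a b ⟨s, hs, ha⟩ ⟨t, ht, hb⟩
    refine ⟨s * t, fun h => (hp.mem_or_mem h).elim hs ht, ?_⟩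
    have : s * t * (a + b) = t * (s * a) + s * (t * b) := by ring
    rw [this]
    exact I.add_mem (I.mul_mem_left _ ha) (I.mul_mem_left _ hb)
  zero_mem' := ⟨1, (Ideal.ne_top_iff_one p).1 hp.ne_top, by simp⟩
  smul_mem' := by
    rintro c a ⟨s, hs, ha⟩
    refine ⟨s, hs, ?_⟩
    have : s * (c • a) = c * (s * a) := by rw [smul_eq_mul]; ring
    rw [this]
    exact I.mul_mem_left _ ha

section Saturation

variable (p : Ideal R) [hp : p.IsPrime] (I : Ideal R)

lemma le_saturation : I ≤ saturation p I := fun r hr =>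
  ⟨1, (Ideal.ne_top_iff_one p).1 hp.ne_top, by simpa using hr⟩

lemma saturation_le (h : I ≤ p) : saturation p I ≤ p := by
  rintro r ⟨s, hs, hr⟩
  exact (hp.mem_or_mem (h hr)).resolve_left hs

lemma mem_saturation_of_mul_mem {s r : R} (hs : s ∉ p) (h : s * r ∈ saturation p I) :
    r ∈ saturation p I := by
  obtain ⟨t, ht, h⟩ := h
  exact ⟨t * s, fun h => (hp.mem_or_mem h).elim ht hs, by rwa [mul_assoc]⟩

lemma exists_mul_saturation_le [IsNoetherianRing R] :
    ∃ s ∉ p, ∀ r ∈ saturation p I, s * r ∈ I := by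
  obtain ⟨T, hT⟩ := IsNoetherian.noetherian (saturation p I)
  have hT' : ∀ t ∈ T, ∃ s ∉ p, s * t ∈ I := fun t ht => by
    have : t ∈ saturation p I := by rw [← hT]; exact Submodule.subset_span ht
    exact this
  have : ∃ s ∉ p, ∀ t ∈ T, s * t ∈ I := by
    classical
    clear hT
    induction T using Finset.induction_on with
    | empty => exact ⟨1, (Ideal.ne_top_iff_one p).1 hp.ne_top, by simp⟩
    | insert a T _ ih =>
      obtain ⟨s, hs, h⟩ := ih fun t ht => hT' t (Finset.mem_insert_of_mem ht)
      obtain ⟨s', hs', h'⟩ := hT' a (Finset.mem_insert_self _ _)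
      refine ⟨s * s', fun h => (hp.mem_or_mem h).elim hs hs', fun t ht => ?_⟩
      rcases Finset.mem_insert.1 ht with rfl | ht
      · rw [mul_assoc]
        exact I.mul_mem_left _ h'
      · rw [mul_comm s, mul_assoc]
        exact I.mul_mem_left _ (h t ht)
  obtain ⟨s, hs, h⟩ := this
  refine ⟨s, hs, fun r hr => ?_⟩
  rw [← hT] at hr
  induction hr using Submodule.span_induction with
  | mem x hx => exact h x hx
  | zero => simp
  | add x y _ _ hx hy => rw [mul_add]; exact I.add_mem hx hy
  | smul a x _ hx =>
    rw [smul_eq_mul, mul_left_comm]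
    exact I.mul_mem_left _ hx

/-- The passage from `R/I` to its quotient by the torsion at a prime is harmless up to elements
outside of the prime. -/
lemma exists_extKill_saturation [IsNoetherianRing R] {V : Type u} [AddCommGroup V] [Module R V]
    {j : ℕ} (h : ∃ s ∉ p, ExtKill s (j + 1) (R ⧸ I) V) :
    ∃ s ∉ p, ExtKill s (j + 1) (R ⧸ saturation p I) V := by
  obtain ⟨s, hs, h⟩ := h
  obtain ⟨t, ht, h'⟩ := exists_mul_saturation_le p I
  let q : (R ⧸ I) →ₗ[R] (R ⧸ saturation p I) := Submodule.factor (le_saturation p I)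
  have hK : ExtKill t j (LinearMap.ker q) V := by
    refine extKill_of_smul_left ?_ j
    rintro ⟨x, hx⟩
    obtain ⟨r, rfl⟩ := Submodule.mkQ_surjective _ x
    have hr : r ∈ saturation p I := (Submodule.Quotient.mk_eq_zero _).1 hx
    exact Subtype.ext ((Submodule.Quotient.mk_eq_zero _).2 (h' r hr))
  exact ⟨t * s, fun h => (hp.mem_or_mem h).elim ht hs,
    ExtKill.contra_right (SES.ofSurj q (Submodule.factor_surjective _)) hK h⟩

/-- In large degrees, a top nonvanishing `Ext` out of `R/p` is torsion at the prime `p`. -/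
lemma exists_extKill_bound [IsNoetherianRing R] : ∃ e : ℕ, ∀ (V : ModuleCat.{u} R) (n : ℕ), e < n →
    (∀ N : ModuleCat.{u} R, ExtZ R (n + 1) N V) → ∃ s ∉ p, ExtKill s n (R ⧸ p) V := by
  suffices H : ∀ J : Ideal R, J ≤ p → saturation p J ≤ J → ∀ e : ℕ,
      (∀ (V : ModuleCat.{u} R) (j : ℕ), e < j → ∃ s ∉ p, ExtKill s j (R ⧸ J) V) →
      ∃ e : ℕ, ∀ (V : ModuleCat.{u} R) (n : ℕ), e < n →
        (∀ N : ModuleCat.{u} R, ExtZ R (n + 1) N V) → ∃ s ∉ p, ExtKill s n (R ⧸ p) V by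
    refine H (saturation p ⊥) (saturation_le p _ bot_le) ?_ 0 ?_
    · rintro r ⟨s, hs, h⟩
      exact mem_saturation_of_mul_mem p _ hs h
    · intro V j hj
      obtain ⟨j, rfl⟩ := Nat.exists_eq_add_of_lt hj
      rw [zero_add]
      refine exists_extKill_saturation p _ ⟨1, (Ideal.ne_top_iff_one p).1 hp.ne_top, ?_⟩
      have : Module.Projective R (R ⧸ (⊥ : Ideal R)) :=
        Module.Projective.of_equiv (Submodule.quotEquivOfEqBot (⊥ : Ideal R) rfl).symm
      exact extZ_of_projective j
  intro J
  induction J using WellFoundedGT.induction with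
  | ind J ih =>
    intro hJp hJ e he
    by_cases hreg : ∃ y ∈ p, ∀ r, r * y ∈ J → r ∈ J
    · obtain ⟨y, hy, hreg⟩ := hreg
      have S := SES.colon (I := J) (K := J) y fun r => ⟨fun h => J.mul_mem_right y h, hreg r⟩
      refine ih (saturation p (J ⊔ Ideal.span {y})) (lt_of_le_of_ne
        (le_sup_left.trans (le_saturation p _)) fun hh => ?_) (saturation_le p _ ?_) ?_ (e + 1) ?_
      · have hyJ : y ∈ J := by
          rw [hh]
          exact le_saturation p _ (Ideal.mem_sup_right (Ideal.mem_span_singleton_self y))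
        exact (Ideal.ne_top_iff_one p).1 hp.ne_top (hJp (hreg 1 (by simpa using hyJ)))
      · exact sup_le hJp ((Ideal.span_singleton_le_iff_mem _).2 hy)
      · rintro r ⟨s, hs, h⟩
        exact mem_saturation_of_mul_mem p _ hs h
      · intro V j hj
        obtain ⟨j, rfl⟩ : ∃ k, j = k + 1 := ⟨j - 1, by omega⟩
        obtain ⟨s, hs, h1⟩ := he V j (by omega)
        obtain ⟨t, ht, h2⟩ := he V (j + 1) (by omega)
        exact exists_extKill_saturation p _
          ⟨s * t, fun h => (hp.mem_or_mem h).elim hs ht, ExtKill.contra_right S h1 h2⟩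
    · have hns : ¬ Subsingleton ((R ⧸ p) →ₗ[R] (R ⧸ J)) := by
        rw [IsSMulRegular.subsingleton_linearMap_iff]
        rintro ⟨y, hy, hy'⟩
        refine hreg ⟨y, ?_, fun r hr => ?_⟩
        · simpa [Ideal.annihilator_quotient] using hy
        · refine (Submodule.Quotient.mk_eq_zero J).1 (hy' ?_)
          change y • J.mkQ r = y • (0 : R ⧸ J)
          rw [smul_zero, ← map_smul, smul_eq_mul, mul_comm]
          exact (Submodule.Quotient.mk_eq_zero J).2 hr
      rw [not_subsingleton_iff_nontrivial] at hns
      obtain ⟨φ, hφ⟩ := exists_ne (0 : (R ⧸ p) →ₗ[R] (R ⧸ J))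
      obtain ⟨a, ha⟩ := J.mkQ_surjective (φ (p.mkQ 1))
      have hr : ∀ r, φ (p.mkQ r) = J.mkQ (r * a) := fun r => by
        rw [← smul_eq_mul r a, map_smul, ha, ← map_smul φ, ← map_smul p.mkQ, smul_eq_mul, mul_one]
      have haJ : a ∉ J := by
        intro haJ
        refine hφ (LinearMap.ext fun x => ?_)
        obtain ⟨r, rfl⟩ := p.mkQ_surjective x
        rw [hr]
        exact (Submodule.Quotient.mk_eq_zero J).2 (J.mul_mem_left r haJ)
      have S := SES.colon (I := J) (K := p) a fun r => by
        constructor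
        · intro h
          refine (Submodule.Quotient.mk_eq_zero J).1 ((hr r).symm.trans ?_)
          have : p.mkQ r = 0 := (Submodule.Quotient.mk_eq_zero p).2 h
          rw [this, map_zero]
        · intro h
          by_contra hrp
          exact haJ (hJ ⟨r, hrp, h⟩)
      refine ⟨e, fun V n hn hV => ?_⟩
      obtain ⟨s, hs, h1⟩ := he V n hn
      exact ⟨s * 1, by rwa [mul_one], ExtKill.contra_left S h1 (hV (ModuleCat.of R _))⟩

end Saturation

/-- A module of finite flat dimension which is an infinite syzygy of flat modules is flat. -/
theorem FD.flat_of_coresolution [IsNoetherianRing R] (𝓟 : ModuleCat.{u} R → Prop)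
    (h𝓟 : ∀ B, 𝓟 B → ∃ F C : ModuleCat.{u} R, Module.Flat R F ∧ Nonempty (SES R B F C) ∧ 𝓟 C)
    {B : Type u} [AddCommGroup B] [Module R B] (hB : 𝓟 (ModuleCat.of R B)) {n : ℕ}
    (h : FD R n B) : Module.Flat R B := by
  induction n with
  | zero => exact h.flat
  | succ n ih =>
    refine ih (h.pred (TV.of_prime fun p hp => ?_))
    obtain ⟨e, he⟩ := exists_extKill_bound p
    have key : ∀ (l m : ℕ) (B : ModuleCat.{u} R), e < m + 1 + l → 𝓟 B → FD R (m + 1) B →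
        ∃ s ∉ p, ExtKill s (m + 1) (R ⧸ p) (CharacterModule B) := by
      intro l
      induction l with
      | zero =>
        intro m B hl _ hB
        exact he (ModuleCat.of R (CharacterModule B)) _ hl fun N => hB.tv N (Nat.lt_succ_self _)
      | succ l ihl =>
        intro m B hl h𝓟B hB
        obtain ⟨F, C, hF, ⟨S⟩, hC⟩ := h𝓟 B h𝓟B
        obtain ⟨s, hs, hk⟩ := ihl (m + 1) C (by omega) hC (FD.right S hB (fd_of_flat _))
        exact ⟨1 * s, by rwa [one_mul], ExtKill.co_right S.dual (tv_of_flat m) hk⟩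
    exact key e n (ModuleCat.of R B) (by omega) hB h

end GFlat

namespace GFlat

open CategoryTheory Abelian IsLocalRing

variable {R : Type u} [CommRing R]

section Cpl

variable {T T₁ T₂ T₃ : Type u} [AddCommGroup T] [Module R T] [AddCommGroup T₁] [Module R T₁]
    [AddCommGroup T₂] [Module R T₂] [AddCommGroup T₃] [Module R T₃]

/-- The module `T` is derived complete and separated along the endomorphism `φ`: every system
`s n - φ (s (n + 1)) = u n` has exactly one solution. -/
def Cpl (φ : T →ₗ[R] T) : Prop :=
  ∀ u : ℕ → T, ∃! s : ℕ → T, ∀ n, s n = u n + φ (s (n + 1))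

lemma Cpl.exists_solution {φ : T →ₗ[R] T} (h : Cpl φ) (u : ℕ → T) :
    ∃ s : ℕ → T, ∀ n, s n = u n + φ (s (n + 1)) := (h u).exists

lemma Cpl.eq_zero {φ : T →ₗ[R] T} (h : Cpl φ) {s : ℕ → T} (hs : ∀ n, s n = φ (s (n + 1)))
    (n : ℕ) : s n = 0 := by
  have := (h 0).unique (y₁ := s) (y₂ := 0) (fun n => by simpa using hs n) (fun n => by simp)
  rw [this]
  rfl

lemma Cpl.intro {φ : T →ₗ[R] T} (h : ∀ u : ℕ → T, ∃ s : ℕ → T, ∀ n, s n = u n + φ (s (n + 1)))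
    (h0 : ∀ s : ℕ → T, (∀ n, s n = φ (s (n + 1))) → ∀ n, s n = 0) : Cpl φ := by
  intro u
  obtain ⟨s, hs⟩ := h u
  refine ⟨s, hs, fun s' hs' => ?_⟩
  have := h0 (s' - s) fun n => by
    rw [Pi.sub_apply, Pi.sub_apply, map_sub, hs n, hs' n]
    abel
  exact funext fun n => sub_eq_zero.1 (this n)

lemma Cpl.right {φ₁ : T₁ →ₗ[R] T₁} {φ₂ : T₂ →ₗ[R] T₂} {φ₃ : T₃ →ₗ[R] T₃} (h₁ : Cpl φ₁)
    (h₂ : Cpl φ₂) {f : T₁ →ₗ[R] T₂} {g : T₂ →ₗ[R] T₃} (hfg : Function.Exact f g)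
    (hg : Function.Surjective g) (hf : ∀ t, f (φ₁ t) = φ₂ (f t)) (hg' : ∀ t, g (φ₂ t) = φ₃ (g t)) :
    Cpl φ₃ := by
  refine Cpl.intro (fun u => ?_) fun s hs n => ?_
  · choose v hv using fun n => hg (u n)
    obtain ⟨s, hs⟩ := h₂.exists_solution v
    exact ⟨fun n => g (s n), fun n => by simp only [hs n, map_add, hg', hv]⟩
  · choose t ht using fun n => hg (s n)
    have : ∀ n, ∃ w, f w = t n - φ₂ (t (n + 1)) := fun n => (hfg _).1 (by
      rw [map_sub, hg', ht, ht, hs n, sub_self])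
    choose w hw using this
    obtain ⟨v, hv⟩ := h₁.exists_solution w
    have := h₂.eq_zero (s := fun n => t n - f (v n)) (fun n => by
      rw [map_sub, hv n, map_add, hw, hf]
      abel) n
    rw [← ht n, sub_eq_zero.1 this]
    exact hfg.apply_apply_eq_zero _

lemma Cpl.left {φ₁ : T₁ →ₗ[R] T₁} {φ₂ : T₂ →ₗ[R] T₂} {φ₃ : T₃ →ₗ[R] T₃} (h₂ : Cpl φ₂)
    (h₃ : Cpl φ₃) {f : T₁ →ₗ[R] T₂} {g : T₂ →ₗ[R] T₃} (hfg : Function.Exact f g)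
    (hf : Function.Injective f) (hf' : ∀ t, f (φ₁ t) = φ₂ (f t))
    (hg' : ∀ t, g (φ₂ t) = φ₃ (g t)) : Cpl φ₁ := by
  refine Cpl.intro (fun u => ?_) fun s hs n => ?_
  · obtain ⟨s, hs⟩ := h₂.exists_solution fun n => f (u n)
    have h0 := h₃.eq_zero (s := fun n => g (s n)) (fun n => by
      rw [hs n, map_add, hfg.apply_apply_eq_zero, zero_add, hg'])
    choose v hv using fun n => (hfg _).1 (h0 n)
    exact ⟨v, fun n => hf (by rw [map_add, hf', hv, hv, hs n, ← hs n])⟩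
  · refine hf ?_
    rw [map_zero]
    exact h₂.eq_zero (s := fun n => f (s n)) (fun n => by rw [← hf', ← hs n]) n

/-- Derived completeness and separation along multiplication by `x`. -/
def XCpl (x : R) (T : Type u) [AddCommGroup T] [Module R T] : Prop :=
  Cpl (x • (LinearMap.id : T →ₗ[R] T))

lemma XCpl.right {x : R} (h₁ : XCpl x T₁) (h₂ : XCpl x T₂) {f : T₁ →ₗ[R] T₂} {g : T₂ →ₗ[R] T₃}
    (hfg : Function.Exact f g) (hg : Function.Surjective g) : XCpl x T₃ :=
  Cpl.right h₁ h₂ hfg hg (fun t => map_smul f x t) (fun t => map_smul g x t)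

lemma XCpl.left {x : R} (S : SES R T₁ T₂ T₃) (h₂ : XCpl x T₂) (h₃ : XCpl x T₃) : XCpl x T₁ :=
  Cpl.left h₂ h₃ S.exact S.inj (fun t => map_smul S.f x t) (fun t => map_smul S.g x t)

lemma XCpl.congr {x : R} (h : XCpl x T₁) (e : T₁ ≃ₗ[R] T₂) : XCpl x T₂ :=
  Cpl.right (f := (0 : PUnit.{u + 1} →ₗ[R] T₁)) (φ₁ := LinearMap.id)
    (Cpl.intro (fun _ => ⟨0, fun _ => rfl⟩) fun _ _ _ => rfl) h (g := e.toLinearMap)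
    (fun t => by simp [eq_comm (a := (0 : T₁))]) e.surjective
    (fun t => by simp) (fun t => map_smul e x t)

lemma XCpl.pi {x : R} (h : XCpl x T) (ι : Type) : XCpl x (ι → T) := by
  refine Cpl.intro (fun u => ?_) fun s hs n => ?_
  · choose s hs using fun i => Cpl.exists_solution h fun n => u n i
    exact ⟨fun n i => s i n, fun n => funext fun i => hs i n⟩
  · exact funext fun i => Cpl.eq_zero h (s := fun n => s n i) (fun n => congrFun (hs n) i) n

lemma XCpl.eq_bot_of_le_smul {x : R} (h : XCpl x T) (K : Submodule R T)
    (hK : ∀ k ∈ K, ∃ k' ∈ K, x • k' = k) : K = ⊥ := by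
  rw [eq_bot_iff]
  intro k hk
  choose! d hd hd' using hK
  have hmem : ∀ n, d^[n] k ∈ K := fun n => by
    induction n with
    | zero => exact hk
    | succ n ih => rw [Function.iterate_succ_apply']; exact hd _ ih
  have := Cpl.eq_zero h (s := fun n => d^[n] k) (fun n => by
    change _ = x • (d^[n + 1] k)
    rw [Function.iterate_succ_apply', hd' _ (hmem n)]) 0
  exact this

/-- An adically complete module is complete along every element of the ideal. -/
lemma xCpl_of_isAdicComplete (I : Ideal R) [IsAdicComplete I T] {x : R} (hx : x ∈ I) :
    XCpl x T := by
  have hpow : ∀ (k : ℕ) (t : T), x ^ k • t ∈ (I ^ k • ⊤ : Submodule R T) := fun k t =>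
    Submodule.smul_mem_smul (Ideal.pow_mem_pow hx k) Submodule.mem_top
  refine Cpl.intro (fun u => ?_) fun s hs n => ?_
  · let σ : ℕ → ℕ → T := fun n k => ∑ j ∈ Finset.range k, x ^ j • u (n + j)
    have hσ : ∀ n {k l : ℕ}, k ≤ l → σ n k ≡ σ n l [SMOD (I ^ k • ⊤ : Submodule R T)] := by
      intro n k l hkl
      obtain ⟨l, rfl⟩ := Nat.exists_eq_add_of_le hkl
      rw [SModEq.comm, SModEq.sub_mem]
      have : σ n (k + l) - σ n k = ∑ j ∈ Finset.range l, x ^ (k + j) • u (n + (k + j)) := by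
        simp only [σ]
        rw [Finset.sum_range_add, add_sub_cancel_left]
      rw [this]
      refine Submodule.sum_mem _ fun j _ => ?_
      rw [pow_add, mul_smul]
      exact hpow k _
    choose s hs using fun n => IsPrecomplete.prec (I := I) inferInstance (hσ n)
    refine ⟨s, fun n => ?_⟩
    have hstep : ∀ k, σ n (k + 1) = u n + x • σ (n + 1) k := fun k => by
      simp only [σ]
      rw [Finset.sum_range_succ', Finset.smul_sum, add_comm, pow_zero, one_smul, add_zero]
      congr 1
      refine Finset.sum_congr rfl fun j _ => ?_
      rw [smul_smul, pow_succ', show n + (j + 1) = n + 1 + j by ring]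
    refine sub_eq_zero.1 (IsHausdorff.haus (I := I) inferInstance _ fun k => ?_)
    have h1 := hs n (k + 1)
    have h2 := hs (n + 1) k
    rw [SModEq.sub_mem] at h1 h2
    rw [SModEq.zero]
    have h1' := Submodule.smul_mono_left (N := (⊤ : Submodule R T))
      (Ideal.pow_le_pow_right (I := I) (Nat.le_succ k)) h1
    rw [hstep] at h1'
    have := Submodule.sub_mem _ (Submodule.smul_mem _ x h2) h1'
    convert this using 1
    change s n - (u n + x • s (n + 1)) = _
    rw [smul_sub]
    abel
  · refine IsHausdorff.haus (I := I) inferInstance _ fun k => ?_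
    rw [SModEq.zero]
    have : s n = x ^ k • s (n + k) := by
      induction k with
      | zero => simp
      | succ k ih =>
        rw [ih, hs (n + k), pow_succ, mul_smul]
        rfl
    rw [this]
    exact hpow k _

end Cpl

end GFlat

namespace GFlat

open CategoryTheory Abelian IsLocalRing

variable {R : Type u} [CommRing R]

section LX

variable {A B C : Type u} [AddCommGroup A] [Module R A] [AddCommGroup B] [Module R B]
    [AddCommGroup C] [Module R C]

variable (R A) in
/-- Multiplication by the variable on sequences, viewed as power series. -/
def tShift : (ℕ → A) →ₗ[R] (ℕ → A) where
  toFun f n := Nat.casesOn n 0 f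
  map_add' f g := funext fun n => by cases n <;> simp
  map_smul' r f := funext fun n => by cases n <;> simp

lemma tShift_zero (f : ℕ → A) : tShift R A f 0 = 0 := rfl

lemma tShift_succ (f : ℕ → A) (n : ℕ) : tShift R A f (n + 1) = f n := rfl

variable (A) in
/-- Multiplication by `t - x` on power series with coefficients in `A`. -/
def muMap (x : R) : (ℕ → A) →ₗ[R] (ℕ → A) := tShift R A - x • LinearMap.id

lemma muMap_zero (x : R) (f : ℕ → A) : muMap A x f 0 = -(x • f 0) := by
  simp [muMap, tShift_zero]

lemma muMap_succ (x : R) (f : ℕ → A) (n : ℕ) : muMap A x f (n + 1) = f n - x • f (n + 1) := rfl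

lemma muMap_comp (x : R) (φ : A →ₗ[R] B) (f : ℕ → A) :
    muMap B x (fun n => φ (f n)) = fun n => φ (muMap A x f n) := by
  funext n
  cases n with
  | zero => rw [muMap_zero, muMap_zero, map_neg, map_smul]
  | succ n => rw [muMap_succ, muMap_succ, map_sub, map_smul]

/-- Multiplication by `t - x` on power series with coefficients in `A` is injective. -/
def MuInj (x : R) (A : Type u) [AddCommGroup A] [Module R A] : Prop :=
  ∀ f, muMap A x f = 0 → f = 0

lemma muMap_eq_zero {x : R} {f : ℕ → A} (h : muMap A x f = 0) :
    x • f 0 = 0 ∧ ∀ n, f n = x • f (n + 1) :=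
  ⟨by simpa [muMap_zero] using congrFun h 0,
    fun n => by simpa [muMap_succ, sub_eq_zero] using congrFun h (n + 1)⟩

lemma MuInj.left {x : R} (h : MuInj x B) (φ : A →ₗ[R] B) (hφ : Function.Injective φ) :
    MuInj x A := by
  intro f hf
  have := h (fun n => φ (f n)) (by rw [muMap_comp, hf]; funext n; exact map_zero φ)
  exact funext fun n => hφ ((congrFun this n).trans (map_zero φ).symm)

lemma MuInj.mid {x : R} (S : SES R A B C) (hA : MuInj x A) (hC : MuInj x C) : MuInj x B := by
  intro f hf
  have := hC (fun n => S.g (f n)) (by rw [muMap_comp, hf]; funext n; exact map_zero S.g)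
  choose f' hf' using fun n => S.lift (congrFun this n)
  obtain rfl : (fun n => S.f (f' n)) = f := funext hf'
  rw [muMap_comp] at hf
  rw [hA f' (funext fun n => S.inj ((congrFun hf n).trans (map_zero S.f).symm))]
  exact funext fun n => map_zero S.f

lemma XCpl.muInj {x : R} (h : XCpl x A) : MuInj x A := fun _ hf =>
  funext (Cpl.eq_zero h (muMap_eq_zero hf).2)

/-- Bounded `x`-torsion implies injectivity. -/
lemma muInj_of_bounded {x : R} (c : ℕ) (h : ∀ (m : ℕ) (a : A), x ^ m • a = 0 → x ^ c • a = 0) :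
    MuInj x A := by
  intro f hf
  obtain ⟨h0, h1⟩ := muMap_eq_zero hf
  have h2 : ∀ n, x ^ (n + 1) • f n = 0 := fun n => by
    induction n with
    | zero => simpa using h0
    | succ n ih => rw [pow_succ, mul_smul, ← h1, ih]
  have h3 : ∀ n k, f n = x ^ k • f (n + k) := fun n k => by
    induction k with
    | zero => simp
    | succ k ih => rw [ih, pow_succ, mul_smul, h1 (n + k)]; rfl
  funext n
  rw [h3 n c]
  exact h _ _ (h2 _)

/-- The quotient of a flat module by an ideal has bounded torsion. -/
lemma muInj_flat_quotient [IsNoetherianRing R] (x : R) {F : Type u} [AddCommGroup F] [Module R F]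
    [Module.Flat R F] {l : ℕ} (f : Fin l → R) :
    MuInj x (F ⧸ (Ideal.span (Set.range f) • ⊤ : Submodule R F)) := by
  let I := Ideal.span (Set.range f)
  obtain ⟨c, hc⟩ := monotone_stabilizes_iff_noetherian.2 (inferInstanceAs (IsNoetherian R R))
    ⟨fun m => I.colon {x ^ m}, fun m m' hm r hr => by
      rw [Submodule.mem_colon_singleton] at hr ⊢
      obtain ⟨d, rfl⟩ := Nat.exists_eq_add_of_le hm
      rw [pow_add, smul_eq_mul, ← mul_assoc]
      exact I.mul_mem_right _ hr⟩
  have hcol : ∀ m r, r * x ^ m ∈ I → r * x ^ c ∈ I := fun m r hr => by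
    have h1 : r ∈ I.colon {x ^ (m + c)} := by
      rw [Submodule.mem_colon_singleton, smul_eq_mul, pow_add, ← mul_assoc]
      exact I.mul_mem_right _ hr
    have h2 : r ∈ I.colon {x ^ c} := by
      have := hc (m + c) (Nat.le_add_left _ _)
      exact this.symm.le h1
    rwa [Submodule.mem_colon_singleton] at h2
  refine muInj_of_bounded c fun m a ha => ?_
  obtain ⟨t, rfl⟩ := Submodule.mkQ_surjective _ a
  rw [← map_smul] at ha ⊢
  replace ha := (Submodule.Quotient.mk_eq_zero _).1 ha
  refine (Submodule.Quotient.mk_eq_zero _).2 ?_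
  obtain ⟨w, hw⟩ : ∃ w : Fin l → F, x ^ m • t = ∑ i, f i • w i := by
    refine Submodule.smul_induction_on ha ?_ ?_
    · intro r hr n _
      obtain ⟨b, rfl⟩ := (Submodule.mem_span_range_iff_exists_fun R).1 hr
      refine ⟨fun i => b i • n, ?_⟩
      rw [Finset.sum_smul]
      exact Finset.sum_congr rfl fun i _ => by rw [smul_eq_mul, mul_comm, mul_smul]
    · rintro _ _ ⟨w, rfl⟩ ⟨w', rfl⟩
      exact ⟨w + w', by simp [Finset.sum_add_distrib]⟩
  obtain ⟨k, a, h1, -, h2⟩ := exists_relation_matrix (Fin.cons (x ^ m) f : Fin (l + 1) → R)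
  obtain ⟨y, hy⟩ := h2 F (Fin.cons t fun i => -w i) (by
    rw [Fin.sum_univ_succ]
    simp [hw])
  have ht : t = ∑ j, a 0 j • y j := by simpa using hy 0
  rw [ht, Finset.smul_sum]
  refine Submodule.sum_mem _ fun j _ => ?_
  rw [smul_smul]
  refine Submodule.smul_mem_smul ?_ Submodule.mem_top
  rw [mul_comm]
  refine hcol m _ ?_
  have h3 := h1 j
  rw [Fin.sum_univ_succ] at h3
  simp only [Fin.cons_zero, Fin.cons_succ] at h3
  rw [mul_comm, eq_neg_of_add_eq_zero_left h3]
  exact I.neg_mem (Ideal.sum_mem _ fun i _ =>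
    I.mul_mem_right _ (Ideal.subset_span ⟨i, rfl⟩))

lemma muInj_of_flat [IsNoetherianRing R] (x : R) {F : Type u} [AddCommGroup F] [Module R F]
    [Module.Flat R F] : MuInj x F := by
  have h := muInj_flat_quotient x (F := F) (Fin.elim0 : Fin 0 → R)
  refine h.left (Submodule.mkQ _) ?_
  rw [← LinearMap.ker_eq_bot, Submodule.ker_mkQ]
  simp [Set.range_eq_empty]

lemma GF.muInj [IsNoetherianRing R] (h : GF R A) (x : R) : MuInj x A := by
  obtain ⟨F, C, hF, ⟨S⟩, -⟩ := h.exists_embedding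
  exact (muInj_of_flat x).left S.f S.inj

/-- The quotient `A⟦t⟧ / (t - x)`, an underived form of derived `x`-completion. -/
abbrev LX (x : R) (A : Type u) [AddCommGroup A] [Module R A] : Type u :=
  (ℕ → A) ⧸ LinearMap.range (muMap A x)

/-- Functoriality of `LX`. -/
def LX.map (x : R) (φ : A →ₗ[R] B) : LX x A →ₗ[R] LX x B :=
  Submodule.mapQ _ _ (φ.compLeft ℕ) (by
    rintro _ ⟨f, rfl⟩
    exact ⟨fun n => φ (f n), muMap_comp x φ f⟩)

lemma LX.map_mk (x : R) (φ : A →ₗ[R] B) (f : ℕ → A) :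
    LX.map x φ (Submodule.mkQ _ f) = Submodule.mkQ _ fun n => φ (f n) := rfl

lemma LX.mk_eq_zero {x : R} {f : ℕ → A} :
    (LinearMap.range (muMap A x)).mkQ f = 0 ↔ ∃ h, muMap A x h = f :=
  Submodule.Quotient.mk_eq_zero _

/-- `LX` preserves short exact sequences with suitable right term. -/
def SES.lx (x : R) (S : SES R A B C) (hC : MuInj x C) : SES R (LX x A) (LX x B) (LX x C) where
  f := LX.map x S.f
  g := LX.map x S.g
  inj := by
    rw [injective_iff_map_eq_zero]
    intro a ha
    obtain ⟨f, rfl⟩ := Submodule.mkQ_surjective _ a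
    rw [LX.map_mk, LX.mk_eq_zero] at ha
    obtain ⟨b, hb⟩ := ha
    have := hC (fun n => S.g (b n)) (by
      rw [muMap_comp, hb]; funext n; exact S.gf _)
    choose a' ha' using fun n => S.lift (congrFun this n)
    obtain rfl : (fun n => S.f (a' n)) = b := funext ha'
    rw [muMap_comp] at hb
    exact LX.mk_eq_zero.2 ⟨a', funext fun n => S.inj (congrFun hb n)⟩
  surj := fun c => by
    obtain ⟨f, rfl⟩ := Submodule.mkQ_surjective _ c
    choose b hb using fun n => S.surj (f n)
    exact ⟨Submodule.mkQ _ b, by rw [LX.map_mk, funext hb]⟩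
  exact := fun b => by
    obtain ⟨f, rfl⟩ := Submodule.mkQ_surjective _ b
    rw [LX.map_mk, LX.mk_eq_zero]
    constructor
    · rintro ⟨c, hc⟩
      choose b hb using fun n => S.surj (c n)
      obtain rfl : (fun n => S.g (b n)) = c := funext hb
      rw [muMap_comp] at hc
      choose a ha using fun n => S.lift (b := f n - muMap B x b n) (by
        rw [map_sub, congrFun hc n, sub_self])
      refine ⟨Submodule.mkQ _ a, ?_⟩
      rw [LX.map_mk, funext ha]
      refine (Submodule.Quotient.eq _).2 ⟨-b, ?_⟩
      funext n
      simp
    · rintro ⟨a, ha⟩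
      obtain ⟨a, rfl⟩ := Submodule.mkQ_surjective _ a
      rw [LX.map_mk] at ha
      obtain ⟨b, hb⟩ := (Submodule.Quotient.eq _).1 ha
      refine ⟨fun n => S.g (-b n), ?_⟩
      rw [muMap_comp]
      have hb' : muMap B x (fun n => -b n) = fun n => f n - S.f (a n) := by
        have : muMap B x (-b) = -muMap B x b := map_neg _ _
        change muMap B x (-b) = _
        rw [this, hb]
        funext n
        simp
      rw [hb']
      funext n
      rw [map_sub, S.gf, sub_zero]

/-- The unit `A → LX A` sending an element to the constant power series. -/
def LX.unit (x : R) (A : Type u) [AddCommGroup A] [Module R A] : A →ₗ[R] LX x A :=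
  Submodule.mkQ _ ∘ₗ LinearMap.single R (fun _ : ℕ => A) 0

lemma LX.map_unit (x : R) (φ : A →ₗ[R] B) (a : A) :
    LX.map x φ (LX.unit x A a) = LX.unit x B (φ a) := by
  change LX.map x φ (Submodule.mkQ _ (Pi.single 0 a)) = Submodule.mkQ _ (Pi.single 0 (φ a))
  rw [LX.map_mk]
  congr 1
  funext n
  cases n <;> simp

lemma LX.unit_bijective {x : R} (h : XCpl x A) : Function.Bijective (LX.unit x A) := by
  constructor
  · rw [injective_iff_map_eq_zero]
    intro a ha
    obtain ⟨f, hf⟩ := LX.mk_eq_zero.1 ha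
    have h0 := Cpl.eq_zero h (s := f) (fun n => by
      have := congrFun hf (n + 1)
      rw [muMap_succ] at this
      exact sub_eq_zero.1 (this.trans (by simp)))
    have := congrFun hf 0
    rw [muMap_zero, h0 0] at this
    simpa using this.symm
  · intro b
    obtain ⟨g, rfl⟩ := Submodule.mkQ_surjective _ b
    obtain ⟨f, hf⟩ := Cpl.exists_solution h fun n => g (n + 1)
    refine ⟨g 0 + x • f 0, (Submodule.Quotient.eq _).2 ⟨-f, funext fun n => ?_⟩⟩
    cases n with
    | zero => simp [muMap_zero]
    | succ n =>
      rw [muMap_succ, Pi.neg_apply, hf n]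
      simp

lemma LX.xCpl_self (x : R) (A : Type u) [AddCommGroup A] [Module R A] : XCpl x (LX x A) := by
  have ht : Cpl (tShift R A) := by
    refine Cpl.intro (fun u => ?_) fun s hs n => ?_
    · let σ : ℕ → ℕ → A := fun j => Nat.rec (fun n => u n 0) (fun j f n => u n (j + 1) + f (n + 1)) j
      refine ⟨fun n j => σ j n, fun n => funext fun j => ?_⟩
      cases j with
      | zero => exact (add_zero _).symm
      | succ j => rfl
    · have : ∀ j n, s n j = 0 := fun j => by
        induction j with
        | zero => intro n; rw [hs n]; rfl
        | succ j ih => intro n; rw [hs n]; exact ih _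
      exact funext fun j => this j n
  refine Cpl.right ht ht (f := muMap A x) (g := Submodule.mkQ _)
    (LinearMap.exact_map_mkQ_range _) (Submodule.mkQ_surjective _) (fun f => ?_) fun f => ?_
  · simp [muMap]
  · refine (Submodule.Quotient.eq _).2 ⟨f, rfl⟩

lemma XCpl.lx {x y : R} (h : XCpl y A) : XCpl y (LX x A) :=
  XCpl.right (h.pi ℕ) (h.pi ℕ) (LinearMap.exact_map_mkQ_range (muMap A x))
    (Submodule.mkQ_surjective _)

lemma flat_lx [IsNoetherianRing R] (x : R) (F : Type u) [AddCommGroup F] [Module R F]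
    [Module.Flat R F] : Module.Flat R (LX x F) := by
  refine flat_of_relation_matrix fun {l} f => ?_
  obtain ⟨k, a, ha, -, hF⟩ := exists_relation_matrix f
  refine ⟨k, a, ha, fun z hz => ?_⟩
  choose g hg using fun i => Submodule.mkQ_surjective _ (z i)
  obtain ⟨h, hh⟩ : ∃ h, muMap F x h = ∑ i, f i • g i := by
    rw [← LX.mk_eq_zero, map_sum, ← hz]
    exact Finset.sum_congr rfl fun i _ => by rw [map_smul, hg]
  let I := Ideal.span (Set.range f)
  let q := (I • ⊤ : Submodule R F).mkQ
  have hq : ∀ n, ∃ w : Fin l → F, h n = ∑ i, f i • w i := by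
    have h0 := muInj_flat_quotient x (F := F) f (fun n => q (h n)) (by
      rw [muMap_comp, hh]
      funext n
      refine (Submodule.Quotient.mk_eq_zero _).2 ?_
      rw [Finset.sum_apply]
      exact Submodule.sum_mem _ fun i _ =>
        Submodule.smul_mem_smul (Ideal.subset_span ⟨i, rfl⟩) Submodule.mem_top)
    intro n
    have hn := (Submodule.Quotient.mk_eq_zero _).1 (congrFun h0 n)
    refine Submodule.smul_induction_on hn ?_ ?_
    · intro r hr n _
      obtain ⟨b, rfl⟩ := (Submodule.mem_span_range_iff_exists_fun R).1 hr
      refine ⟨fun i => b i • n, ?_⟩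
      rw [Finset.sum_smul]
      exact Finset.sum_congr rfl fun i _ => by rw [smul_eq_mul, mul_comm, mul_smul]
    · rintro _ _ ⟨w, rfl⟩ ⟨w', rfl⟩
      exact ⟨w + w', by simp [Finset.sum_add_distrib]⟩
  choose w hw using hq
  have hrel : ∀ n, ∑ i, f i • (g i n - muMap F x (fun n => w n i) n) = 0 := fun n => by
    have h1 : muMap F x h n = ∑ i, f i • muMap F x (fun n => w n i) n := by
      have h2 : h = ∑ i, f i • fun n => w n i := by
        funext n
        rw [hw n, Finset.sum_apply]
        rfl
      rw [h2, map_sum, Finset.sum_apply]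
      exact Finset.sum_congr rfl fun i _ => by rw [map_smul]; rfl
    simp_rw [smul_sub]
    rw [Finset.sum_sub_distrib, ← h1, hh, Finset.sum_apply]
    exact sub_self _
  choose y hy using fun n => hF F _ (hrel n)
  refine ⟨fun j => Submodule.mkQ _ fun n => y n j, fun i => ?_⟩
  have : z i = Submodule.mkQ _ (fun n => g i n - muMap F x (fun n => w n i) n) := by
    rw [← hg]
    exact (Submodule.Quotient.eq _).2 ⟨fun n => w n i, by funext n; simp⟩
  rw [this]
  simp_rw [← map_smul]
  rw [← map_sum]
  congr 1
  funext n
  rw [hy n i, Finset.sum_apply]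
  rfl

lemma FD.lx [IsNoetherianRing R] {x : R} {n : ℕ} {H : Type u} [AddCommGroup H] [Module R H]
    (h : FD R n H) (hH : MuInj x H) : FD R n (LX x H) := by
  induction n generalizing H with
  | zero =>
    have := h.flat
    have := flat_lx x H
    exact fd_of_flat 0
  | succ n ih =>
    obtain ⟨G, _, π, hπ⟩ := exists_free_cover (R := R) H
    let S := SES.ofSurj π hπ
    have hK := ih (FD.left S (fd_of_flat _) h) ((muInj_of_flat x).left S.f S.inj)
    have := flat_lx x G
    exact FD.right (S.lx x hH) hK (fd_of_flat _)

end LX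

end GFlat

namespace GFlat

open CategoryTheory Abelian IsLocalRing

section Snake

variable {R : Type u} [CommRing R]
variable {A B C A' B' C' : Type u} [AddCommGroup A] [Module R A] [AddCommGroup B] [Module R B]
    [AddCommGroup C] [Module R C] [AddCommGroup A'] [Module R A'] [AddCommGroup B'] [Module R B']
    [AddCommGroup C'] [Module R C']

/-- The kernels in a morphism of short exact sequences with surjective left component. -/
lemma exists_ker_ses (S : SES R A B C) (T : SES R A' B' C') (α : A →ₗ[R] A') (β : B →ₗ[R] B')
    (γ : C →ₗ[R] C') (hα : Function.Surjective α) (hf : ∀ a, β (S.f a) = T.f (α a))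
    (hg : ∀ b, γ (S.g b) = T.g (β b)) :
    Nonempty (SES R (LinearMap.ker α) (LinearMap.ker β) (LinearMap.ker γ)) := by
  refine ⟨{ f := S.f.restrict (p := LinearMap.ker α) (q := LinearMap.ker β) fun a ha => ?_
            g := S.g.restrict (p := LinearMap.ker β) (q := LinearMap.ker γ) fun b hb => ?_
            inj := ?_, surj := ?_, exact := ?_ }⟩
  · rw [LinearMap.mem_ker] at ha ⊢
    rw [hf, ha, map_zero]
  · rw [LinearMap.mem_ker] at hb ⊢
    rw [hg, hb, map_zero]
  · intro a a' h
    exact Subtype.ext (S.inj (congrArg Subtype.val h))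
  · rintro ⟨c, hc⟩
    rw [LinearMap.mem_ker] at hc
    obtain ⟨b, rfl⟩ := S.surj c
    rw [hg] at hc
    obtain ⟨a', ha'⟩ := T.lift hc
    obtain ⟨a, rfl⟩ := hα a'
    refine ⟨⟨b - S.f a, ?_⟩, Subtype.ext ?_⟩
    · rw [LinearMap.mem_ker, map_sub, hf, ha', sub_self]
    · change S.g (b - S.f a) = S.g b
      rw [map_sub, S.gf, sub_zero]
  · rintro ⟨b, hb⟩
    rw [LinearMap.mem_ker] at hb
    constructor
    · intro h
      obtain ⟨a, rfl⟩ := S.lift (congrArg Subtype.val h : S.g b = 0)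
      refine ⟨⟨a, ?_⟩, rfl⟩
      rw [hf] at hb
      exact T.inj (hb.trans (map_zero _).symm)
    · rintro ⟨⟨a, ha⟩, h⟩
      obtain rfl : S.f a = b := congrArg Subtype.val h
      exact Subtype.ext (S.gf a)

end Snake

section UnitExt

variable {R : Type u} [CommRing R] {x : R}
variable {A B C G : Type u} [AddCommGroup A] [Module R A] [AddCommGroup B] [Module R B]
    [AddCommGroup C] [Module R C] [AddCommGroup G] [Module R G]

/-- The unit of `LX` together with an auxiliary map, aimed at surjectivity. -/
noncomputable def unitExt (g : G →ₗ[R] LX x A) : A × G →ₗ[R] LX x A := (LX.unit x A).coprod g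

lemma unitExt_apply (g : G →ₗ[R] LX x A) (p : A × G) : unitExt g p = LX.unit x A p.1 + g p.2 := rfl

/-- The sequence `0 → A × G → B × (G × K) → C × K → 0`. -/
noncomputable def SES.prodExt (S : SES R A B C) (G K : Type u) [AddCommGroup G] [Module R G]
    [AddCommGroup K] [Module R K] : SES R (A × G) (B × (G × K)) (C × K) where
  f := S.f.prodMap (LinearMap.inl R G K)
  g := S.g.prodMap (LinearMap.snd R G K)
  inj := Function.Injective.prodMap S.inj LinearMap.inl_injective
  surj := by
    rintro ⟨c, k⟩
    obtain ⟨b, rfl⟩ := S.surj c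
    exact ⟨(b, 0, k), rfl⟩
  exact := by
    rintro ⟨b, g, k⟩
    constructor
    · intro h
      obtain ⟨h₁, h₂⟩ := Prod.ext_iff.1 h
      obtain ⟨a, rfl⟩ := S.lift (show S.g b = 0 from h₁)
      obtain rfl : k = 0 := h₂
      exact ⟨(a, g), rfl⟩
    · rintro ⟨⟨a, g'⟩, h⟩
      obtain ⟨h₁, h₂⟩ := Prod.ext_iff.1 h
      obtain rfl : S.f a = b := h₁
      have h₂ : ((g', 0) : G × K) = (g, k) := h₂
      obtain rfl : 0 = k := congrArg Prod.snd h₂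
      exact Prod.ext (S.gf a) rfl

lemma exists_unitExt_step (S : SES R A B C) (hC : MuInj x C) (hG : Module.Flat R G)
    (g : G →ₗ[R] LX x A) (hg : Function.Surjective (unitExt g)) :
    ∃ (G₁ G₂ : ModuleCat.{u} R) (g₁ : G₁ →ₗ[R] LX x B) (g₂ : G₂ →ₗ[R] LX x C),
      Module.Flat R G₁ ∧ Module.Flat R G₂ ∧ Function.Surjective (unitExt g₁) ∧
      Function.Surjective (unitExt g₂) ∧ Nonempty (SES R (LinearMap.ker (unitExt g))
        (LinearMap.ker (unitExt g₁)) (LinearMap.ker (unitExt g₂))) := by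
  obtain ⟨K, hK, π, hπ⟩ := exists_free_cover (R := R) (LX x B)
  let T := S.lx x hC
  let g₁ : G × K →ₗ[R] LX x B := (T.f ∘ₗ g).coprod π
  let g₂ : K →ₗ[R] LX x C := T.g ∘ₗ π
  have hKf : Module.Flat R K := inferInstance
  refine ⟨ModuleCat.of R (G × K), K, g₁, g₂, flat_prod hG hKf, hKf, fun b => ?_, fun c => ?_, ?_⟩
  · obtain ⟨k, rfl⟩ := hπ b
    refine ⟨((0 : B), ((0 : G), k)), ?_⟩
    change LX.unit x B 0 + (T.f (g 0) + π k) = π k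
    simp
  · obtain ⟨b, rfl⟩ := T.surj c
    obtain ⟨k, rfl⟩ := hπ b
    refine ⟨((0 : C), k), ?_⟩
    change LX.unit x C 0 + T.g (π k) = T.g (π k)
    simp
  · refine exists_ker_ses (S.prodExt G K) T (unitExt g) (unitExt g₁) (unitExt g₂) hg ?_ ?_
    · rintro ⟨a, b⟩
      change LX.unit x B (S.f a) + (T.f (g b) + π 0) = T.f (LX.unit x A a + g b)
      rw [map_zero, add_zero, map_add]
      congr 1
      exact (LX.map_unit x S.f a).symm
    · rintro ⟨b, a, k⟩
      change LX.unit x C (S.g b) + T.g (π k) = T.g (LX.unit x B b + (T.f (g a) + π k))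
      rw [map_add, map_add, T.gf, zero_add]
      congr 1
      exact (LX.map_unit x S.g b).symm

lemma fd_ker_unitExt [IsNoetherianRing R] {n : ℕ} (hA : FD R n A) (hx : MuInj x A)
    (hG : Module.Flat R G) (g : G →ₗ[R] LX x A) (hg : Function.Surjective (unitExt g)) :
    FD R n (LinearMap.ker (unitExt g)) :=
  FD.left (SES.ofSurj _ hg) (FD.mid (SES.prod R A G) hA (fd_of_flat n))
    ((hA.lx hx).mono n.le_succ)

/-- The kernel of an extended unit over a Gorenstein flat module is flat once it has finite flat
dimension. -/
lemma flat_ker_unitExt [IsNoetherianRing R] (hA : GF R A) (hG : Module.Flat R G)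
    (g : G →ₗ[R] LX x A) (hg : Function.Surjective (unitExt g)) {n : ℕ}
    (h : FD R n (LinearMap.ker (unitExt g))) : Module.Flat R (LinearMap.ker (unitExt g)) := by
  refine FD.flat_of_coresolution (fun B => ∃ (A G : ModuleCat.{u} R) (g : G →ₗ[R] LX x A),
    GF R A ∧ Module.Flat R G ∧ Function.Surjective (unitExt g) ∧
      Nonempty (B ≃ₗ[R] LinearMap.ker (unitExt g))) ?_
    ⟨ModuleCat.of R A, ModuleCat.of R G, g, hA, hG, hg, ⟨LinearEquiv.refl R _⟩⟩ h
  rintro B ⟨A, G, g, hA, hG, hg, ⟨e⟩⟩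
  obtain ⟨F, C, hF, ⟨S⟩, hC⟩ := hA.exists_embedding
  obtain ⟨G₁, G₂, g₁, g₂, hG₁, hG₂, hg₁, hg₂, ⟨T⟩⟩ := exists_unitExt_step S (hC.muInj x) hG g hg
  have hker : Module.Flat R (LinearMap.ker (unitExt g₁)) :=
    (fd_ker_unitExt (fd_of_flat 0) (muInj_of_flat x) hG₁ g₁ hg₁).flat
  exact ⟨ModuleCat.of R (LinearMap.ker (unitExt g₁)), ModuleCat.of R (LinearMap.ker (unitExt g₂)),
    hker, ⟨T.congrLeft e⟩, C, G₂, g₂, hC, hG₂, hg₂, ⟨LinearEquiv.refl R _⟩⟩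

/-- Completion preserves Gorenstein flat modules admitting an extended unit with kernel of finite
flat dimension. -/
lemma gf_lx [IsNoetherianRing R] (hA : GF R A) (hG : Module.Flat R G)
    (g : G →ₗ[R] LX x A) (hg : Function.Surjective (unitExt g)) {n : ℕ}
    (h : FD R n (LinearMap.ker (unitExt g))) : GF R (LX x A) := by
  let 𝓒 : ModuleCat.{u} R → Prop := fun A => GF R A ∧ ∃ (G : ModuleCat.{u} R) (g : G →ₗ[R] LX x A),
    Module.Flat R G ∧ Function.Surjective (unitExt g) ∧ Module.Flat R (LinearMap.ker (unitExt g))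
  have h𝓒 : ∀ A, 𝓒 A → ∃ F C : ModuleCat.{u} R, Module.Flat R F ∧ Nonempty (SES R A F C) ∧ 𝓒 C := by
    rintro A ⟨hA, G, g, hG, hg, hk⟩
    obtain ⟨F, C, hF, ⟨S⟩, hC⟩ := hA.exists_embedding
    obtain ⟨G₁, G₂, g₁, g₂, hG₁, hG₂, hg₁, hg₂, ⟨T⟩⟩ := exists_unitExt_step S (hC.muInj x) hG g hg
    exact ⟨F, C, hF, ⟨S⟩, hC, G₂, g₂, hG₂, hg₂, flat_ker_unitExt hC hG₂ g₂ hg₂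
      (FD.right T (fd_of_flat 0) (fd_ker_unitExt (fd_of_flat 1) (muInj_of_flat x) hG₁ g₁ hg₁))⟩
  have htv : ∀ A, 𝓒 A → ∀ E : ModuleCat.{u} R, Module.Injective R E → ∀ i,
      TV R (i + 2) E (LX x A) := by
    rintro A ⟨hA, G, g, hG, hg, hk⟩ E hE i
    exact TV.right (SES.ofSurj _ hg) (tv_of_flat i)
      (TV.mid (SES.prod R A G) (hA.injAcyclic E hE _) (tv_of_flat _))
  have hac : ∀ A, 𝓒 A → InjAcyclic R (LX x A) := by
    intro A hA E hE i
    obtain ⟨F, C, hF, ⟨S⟩, hC⟩ := h𝓒 A hA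
    have := flat_lx x F
    exact TV.left (S.lx x (hC.1.muInj x)) (tv_of_flat i) (htv C hC E hE i)
  refine ⟨fun B => ∃ A, 𝓒 A ∧ Nonempty (LX x A ≃ₗ[R] B), ⟨ModuleCat.of R A,
    ⟨hA, ModuleCat.of R G, g, hG, hg, flat_ker_unitExt hA hG g hg h⟩, ⟨LinearEquiv.refl R _⟩⟩, ?_⟩
  rintro B ⟨A, hA, ⟨e⟩⟩
  refine ⟨(hac A hA).congr e, ?_⟩
  obtain ⟨F, C, hF, ⟨S⟩, hC⟩ := h𝓒 A hA
  exact ⟨ModuleCat.of R (LX x F), ModuleCat.of R (LX x C), flat_lx x F,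
    ⟨(S.lx x (hC.1.muInj x)).congrLeft e.symm⟩, C, hC, ⟨LinearEquiv.refl R _⟩⟩

/-- Completing a resolution of a complete module. -/
lemma exists_lx_ses [IsNoetherianRing R] {n : ℕ} (S : SES R A B C) (hA : XCpl x A) (hB : FD R n B)
    (hC : GF R C) : Nonempty (SES R A (LX x B) (LX x C)) ∧ FD R n (LX x B) ∧ GF R (LX x C) := by
  have hbij := LX.unit_bijective hA
  have hmu := MuInj.mid S hA.muInj (hC.muInj x)
  refine ⟨⟨(S.lx x (hC.muInj x)).congrLeft (LinearEquiv.ofBijective _ hbij)⟩, hB.lx hmu, ?_⟩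
  let g : PUnit.{u + 1} →ₗ[R] LX x A := 0
  have hg : Function.Bijective (unitExt g) := by
    constructor
    · rintro ⟨a, _⟩ ⟨b, _⟩ h
      rw [unitExt_apply, unitExt_apply] at h
      exact Prod.ext (hbij.1 (add_right_cancel h)) rfl
    · intro y
      obtain ⟨a, rfl⟩ := hbij.2 y
      exact ⟨(a, PUnit.unit), (unitExt_apply g _).trans (add_zero _)⟩
  obtain ⟨G₁, G₂, g₁, g₂, hG₁, hG₂, hg₁, hg₂, ⟨T⟩⟩ :=
    exists_unitExt_step S (hC.muInj x) inferInstance g hg.2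
  have hsub : Subsingleton (LinearMap.ker (unitExt g)) := by
    rw [LinearMap.ker_eq_bot.2 hg.1]
    infer_instance
  exact gf_lx hC hG₂ g₂ hg₂ (FD.right T (fun N i _ => TV.of_subsingleton i)
    ((fd_ker_unitExt hB hmu hG₁ g₁ hg₁).mono n.le_succ))

lemma exists_complete_ses [IsNoetherianRing R] {n : ℕ} (h : GD R n A) (xs : List R)
    (hA : ∀ y ∈ xs, XCpl y A) : ∃ B C : ModuleCat.{u} R, Nonempty (SES R A B C) ∧ FD R n B ∧
      GF R C ∧ ∀ y ∈ xs, XCpl y B := by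
  induction xs with
  | nil =>
    obtain ⟨B, C, hS, hB, hC⟩ := h
    exact ⟨B, C, hS, hB, hC, by simp⟩
  | cons x xs ih =>
    obtain ⟨B, C, ⟨S⟩, hB, hC, hxs⟩ := ih fun y hy => hA y (List.mem_cons_of_mem _ hy)
    obtain ⟨hS, hB', hC'⟩ := exists_lx_ses S (hA x List.mem_cons_self) hB hC
    refine ⟨ModuleCat.of R (LX x B), ModuleCat.of R (LX x C), hS, hB', hC', fun y hy => ?_⟩
    rcases List.mem_cons.1 hy with rfl | hy
    · exact LX.xCpl_self y B
    · exact (hxs y hy).lx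

/-- A complete module is a quotient of a complete flat module. -/
lemma exists_complete_flat_cover [IsNoetherianRing R] (xs : List R) (hA : ∀ y ∈ xs, XCpl y A) :
    ∃ (F : ModuleCat.{u} R) (π : F →ₗ[R] A), Module.Flat R F ∧ Function.Surjective π ∧
      ∀ y ∈ xs, XCpl y F := by
  induction xs with
  | nil =>
    obtain ⟨G, hG, π, hπ⟩ := exists_free_cover (R := R) A
    exact ⟨G, π, inferInstance, hπ, by simp⟩
  | cons x xs ih =>
    obtain ⟨F, π, hF, hπ, hxs⟩ := ih fun y hy => hA y (List.mem_cons_of_mem _ hy)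
    let e := LinearEquiv.ofBijective _ (LX.unit_bijective (hA x List.mem_cons_self))
    refine ⟨ModuleCat.of R (LX x F), e.symm.toLinearMap ∘ₗ LX.map x π, flat_lx x F,
      e.symm.surjective.comp ?_, fun y hy => ?_⟩
    · intro a
      obtain ⟨f, rfl⟩ := Submodule.mkQ_surjective _ a
      choose f' hf' using fun n => hπ (f n)
      exact ⟨Submodule.mkQ _ f', (LX.map_mk x π f').trans (congrArg _ (funext hf'))⟩
    · rcases List.mem_cons.1 hy with rfl | hy
      · exact LX.xCpl_self y F
      · exact (hxs y hy).lx

end UnitExt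

end GFlat

namespace GFlat

open CategoryTheory Abelian IsLocalRing TensorProduct

variable {R : Type u} [CommRing R]

section ExtInj

variable {A B C A' B' C' N : Type u} [AddCommGroup A] [Module R A] [AddCommGroup B] [Module R B]
    [AddCommGroup C] [Module R C] [AddCommGroup A'] [Module R A'] [AddCommGroup B'] [Module R B']
    [AddCommGroup C'] [Module R C'] [AddCommGroup N] [Module R N]

/-- The map induced by `φ` on `Ext^i(N, -)` is injective. -/
def ExtInj (i : ℕ) (N : Type u) [AddCommGroup N] [Module R N] (φ : A →ₗ[R] B) : Prop :=
  ∀ e : Abelian.Ext (ModuleCat.of R N) (ModuleCat.of R A) i,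
    e.comp (Abelian.Ext.mk₀ (ModuleCat.ofHom φ)) (add_zero i) = 0 → e = 0

lemma ExtInj.comp {i : ℕ} {φ : A →ₗ[R] B} {ψ : B →ₗ[R] C} (hφ : ExtInj i N φ)
    (hψ : ExtInj i N ψ) : ExtInj i N (ψ ∘ₗ φ) := by
  intro e he
  refine hφ e (hψ _ ?_)
  rw [Abelian.Ext.comp_assoc_of_second_deg_zero, Abelian.Ext.mk₀_comp_mk₀]
  exact he

lemma extInj_of_extZ (S : SES R A B C) {i : ℕ} (h : ExtZ R i N A) : ExtInj i N S.g := by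
  intro e he
  obtain ⟨e', he'⟩ := Abelian.Ext.covariant_sequence_exact₂ (ModuleCat.of R N) S.shortExact e he
  rw [← he', h.eq_zero e', Abelian.Ext.zero_comp]

lemma extInj_zero {φ : A →ₗ[R] B} (hφ : Function.Injective φ) : ExtInj 0 N φ := by
  intro e he
  obtain ⟨f, rfl⟩ := (Abelian.Ext.mk₀_bijective _ _).2 e
  rw [Abelian.Ext.mk₀_comp_mk₀, Abelian.Ext.mk₀_eq_zero_iff] at he
  rw [Abelian.Ext.mk₀_eq_zero_iff]
  ext x
  exact hφ ((DFunLike.congr_fun (congrArg ModuleCat.Hom.hom he) x).trans (map_zero φ).symm)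

lemma extInj_left (S : SES R A B C) {i : ℕ} (h : ∀ j, j < i → ExtZ R j N C) : ExtInj i N S.f := by
  cases i with
  | zero => exact extInj_zero S.inj
  | succ i =>
    intro e he
    obtain ⟨e', he'⟩ := Abelian.Ext.covariant_sequence_exact₁ (ModuleCat.of R N) S.shortExact e he
      rfl
    rw [← he', (h i i.lt_succ_self).eq_zero e', Abelian.Ext.zero_comp]

lemma ExtInj.eq_zero {φ : A →ₗ[R] B} (h : ExtInj 0 N φ) (f : N →ₗ[R] A) (hf : φ ∘ₗ f = 0) :
    f = 0 := by
  have := h (Abelian.Ext.mk₀ (ModuleCat.ofHom f)) (by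
    rw [Abelian.Ext.mk₀_comp_mk₀, ← ModuleCat.ofHom_comp, hf, Abelian.Ext.mk₀_eq_zero_iff]
    rfl)
  rw [Abelian.Ext.mk₀_eq_zero_iff] at this
  simpa using congrArg ModuleCat.Hom.hom this

lemma ExtInj.right (S : SES R A B C) (T : SES R A' B' C') (α : A →ₗ[R] A') (β : B →ₗ[R] B')
    (γ : C →ₗ[R] C') (hf : β ∘ₗ S.f = T.f ∘ₗ α) (hg : γ ∘ₗ S.g = T.g ∘ₗ β) {i : ℕ}
    (hα : ExtInj (i + 1) N α) (hB : ExtZ R i N B) : ExtInj i N γ := by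
  intro e he
  let F : ShortComplex.mk (ModuleCat.ofHom S.f) (ModuleCat.ofHom S.g) (by ext a; exact S.gf a) ⟶
      ShortComplex.mk (ModuleCat.ofHom T.f) (ModuleCat.ofHom T.g) (by ext a; exact T.gf a) :=
    { τ₁ := ModuleCat.ofHom α
      τ₂ := ModuleCat.ofHom β
      τ₃ := ModuleCat.ofHom γ
      comm₁₂ := by ext a; exact (DFunLike.congr_fun hf a).symm
      comm₂₃ := by ext a; exact (DFunLike.congr_fun hg a).symm }
  have hnat := S.shortExact.extClass_naturality T.shortExact F
  have hδ : e.comp S.shortExact.extClass rfl = 0 := by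
    refine hα _ ?_
    have h1 : (e.comp S.shortExact.extClass rfl).comp (Abelian.Ext.mk₀ F.τ₁) (add_zero (i + 1)) =
        (e.comp (Abelian.Ext.mk₀ F.τ₃) (add_zero i)).comp T.shortExact.extClass rfl := by
      rw [Abelian.Ext.comp_assoc_of_third_deg_zero, hnat,
        Abelian.Ext.comp_assoc_of_second_deg_zero]
    refine h1.trans ?_
    have h2 : e.comp (Abelian.Ext.mk₀ F.τ₃) (add_zero i) = 0 := he
    rw [h2, Abelian.Ext.zero_comp]
  obtain ⟨e', he'⟩ := Abelian.Ext.covariant_sequence_exact₃ (ModuleCat.of R N) S.shortExact e rfl hδ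
  rw [← he', hB.eq_zero e', Abelian.Ext.zero_comp]

/-- If `s` annihilates `N` and `s` is regular on `A` with cokernel `C`, then `Ext^{i+1}(N, A)`
vanishes together with `Ext^i(N, C)`. -/
lemma ExtZ.succ_of_smul (S : SES R A A C) {s : R} (hS : S.f = s • LinearMap.id)
    (hN : ∀ n : N, s • n = 0) {i : ℕ} (h : ExtZ R i N C) : ExtZ R (i + 1) N A := by
  refine extZ_of_forall fun e => ?_
  obtain ⟨e', he'⟩ := Abelian.Ext.covariant_sequence_exact₁ (ModuleCat.of R N) S.shortExact e (by
      have : ModuleCat.ofHom S.f = s • 𝟙 (ModuleCat.of R A) := by rw [hS]; rfl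
      change e.comp (Abelian.Ext.mk₀ (ModuleCat.ofHom S.f)) (add_zero _) = 0
      rw [this, Abelian.Ext.mk₀_smul, Abelian.Ext.comp_smul, Abelian.Ext.comp_mk₀_id]
      exact extKill_of_smul_left hN _ e) rfl
  rw [← he', h.eq_zero e', Abelian.Ext.zero_comp]

lemma extZ_zero_of_smul (S : SES R A A C) {s : R} (hS : S.f = s • LinearMap.id)
    (hN : ∀ n : N, s • n = 0) : ExtZ R 0 N A := by
  refine extZ_zero_iff.2 fun f => LinearMap.ext fun n => S.inj ?_
  have h : ∀ a, S.f a = s • a := fun a => by rw [hS]; rfl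
  rw [h, h, ← map_smul, hN, map_zero, LinearMap.zero_apply, smul_zero]

lemma ExtZ.zero_of_injective {φ : A →ₗ[R] B}
    (hφ : Function.Injective φ) (h : ExtZ R 0 N B) : ExtZ R 0 N A :=
  extZ_zero_iff.2 fun f => LinearMap.ext fun n =>
    hφ ((DFunLike.congr_fun (extZ_zero_iff.1 h (φ ∘ₗ f)) n).trans (map_zero φ).symm)

/-- Tensoring a short exact sequence with a flat module on the right. -/
noncomputable def SES.rTensor (S : SES R A B C) (F : Type u) [AddCommGroup F] [Module R F]
    [Module.Flat R F] : SES R (A ⊗[R] F) (B ⊗[R] F) (C ⊗[R] F) where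
  f := S.f.rTensor F
  g := S.g.rTensor F
  inj := Module.Flat.rTensor_preserves_injective_linearMap S.f S.inj
  surj := LinearMap.rTensor_surjective F S.surj
  exact := _root_.rTensor_exact F S.exact S.surj

lemma SES.rTensor_smul {S : SES R A A C} {s : R} (hS : S.f = s • LinearMap.id)
    (F : Type u) [AddCommGroup F] [Module R F] [Module.Flat R F] :
    (S.rTensor F).f = s • LinearMap.id := by
  change S.f.rTensor F = _
  rw [hS, LinearMap.rTensor_smul, LinearMap.rTensor_id]

end ExtInj

section Depth

variable [IsLocalRing R]

lemma smul_residue_eq_zero {x : R} (hx : x ∈ maximalIdeal R) (n : R ⧸ maximalIdeal R) :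
    x • n = 0 := by
  obtain ⟨r, rfl⟩ := Ideal.Quotient.mk_surjective n
  rw [← Ideal.Quotient.mk_eq_mk, ← Submodule.Quotient.mk_smul]
  exact (Submodule.Quotient.mk_eq_zero _).2 ((maximalIdeal R).mul_mem_right r hx)

lemma smul_residue_tensor_eq_zero {F : Type u} [AddCommGroup F] [Module R F] {x : R}
    (hx : x ∈ maximalIdeal R) (u : (R ⧸ maximalIdeal R) ⊗[R] F) : x • u = 0 := by
  induction u using TensorProduct.induction_on with
  | zero => exact smul_zero x
  | tmul a b => rw [TensorProduct.smul_tmul', smul_residue_eq_zero hx, zero_tmul]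
  | add a b ha hb => rw [smul_add, ha, hb, add_zero]

variable [IsNoetherianRing R]

lemma exists_regular_ses {N : Type u} [AddCommGroup N] [Module R N] [Module.Finite R N]
    (h : ExtZ R 0 (R ⧸ maximalIdeal R) N) : ∃ x ∈ maximalIdeal R, ∃ (N' : ModuleCat.{u} R)
      (S : SES R N N N'), Module.Finite R N' ∧ S.f = x • LinearMap.id := by
  have : Subsingleton (R ⧸ maximalIdeal R →ₗ[R] N) :=
    ⟨fun f g => (extZ_zero_iff.1 h f).trans (extZ_zero_iff.1 h g).symm⟩
  obtain ⟨x, hx, hreg⟩ := IsSMulRegular.subsingleton_linearMap_iff.1 this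
  rw [Ideal.annihilator_quotient] at hx
  have hinj : Function.Injective (x • (LinearMap.id : N →ₗ[R] N)) := hreg
  exact ⟨x, hx, ModuleCat.of R (N ⧸ LinearMap.range (x • (LinearMap.id : N →ₗ[R] N))),
    SES.ofInj _ hinj, inferInstanceAs (Module.Finite R (N ⧸ _)), rfl⟩

/-- Tensoring with a flat module does not decrease depth. -/
lemma extZ_tensor {N : Type u} [AddCommGroup N] [Module R N] [Module.Finite R N] {e : ℕ}
    (h : ∀ i < e, ExtZ R i (R ⧸ maximalIdeal R) N) (F : Type u) [AddCommGroup F] [Module R F]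
    [Module.Flat R F] {i : ℕ} (hi : i < e) : ExtZ R i (R ⧸ maximalIdeal R) (N ⊗[R] F) := by
  induction e generalizing N i with
  | zero => omega
  | succ e ih =>
    obtain ⟨x, hx, N', S, hN', hS⟩ := exists_regular_ses (h 0 e.succ_pos)
    cases i with
    | zero => exact extZ_zero_of_smul (S.rTensor F) (S.rTensor_smul hS F) (smul_residue_eq_zero hx)
    | succ i =>
      refine ExtZ.succ_of_smul (S.rTensor F) (S.rTensor_smul hS F) (smul_residue_eq_zero hx)
        (ih (fun j hj => ?_) (by omega))
      exact ExtZ.co_right S (h j (by omega)) (h (j + 1) (by omega))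

lemma residue_lTensor_injective {N : Type u} [AddCommGroup N] [Module R N] [Module.Finite R N]
    {e : ℕ} (h : ∀ i < e, ExtZ R i (R ⧸ maximalIdeal R) N)
    (he : ¬ ExtZ R e (R ⧸ maximalIdeal R) N) {F G : Type u} [AddCommGroup F] [Module R F]
    [Module.Flat R F] [AddCommGroup G] [Module R G] [Module.Flat R G] (f : F →ₗ[R] G)
    (hf : ExtInj e (R ⧸ maximalIdeal R) (f.lTensor N)) :
    Function.Injective (f.lTensor (R ⧸ maximalIdeal R)) := by
  induction e generalizing N with
  | zero =>
    rw [extZ_zero_iff] at he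
    push Not at he
    obtain ⟨ι, hι⟩ := he
    have hsimple : IsSimpleModule R (R ⧸ maximalIdeal R) :=
      (isSimpleModule_iff_isCoatom (m := maximalIdeal R)).2 (Ideal.isMaximal_def.1 inferInstance)
    have hinj : Function.Injective ι := (LinearMap.injective_or_eq_zero ι).resolve_right hι
    rw [injective_iff_map_eq_zero]
    intro u hu
    let v := ι.rTensor F u
    have hv : maximalIdeal R ≤ LinearMap.ker (LinearMap.toSpanSingleton R _ v) := fun x hx => by
      rw [LinearMap.mem_ker, LinearMap.toSpanSingleton_apply, ← map_smul,
        smul_residue_tensor_eq_zero hx, map_zero]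
    have hφ := hf.eq_zero ((maximalIdeal R).liftQ (LinearMap.toSpanSingleton R _ v) hv) (by
      ext
      change f.lTensor N ((1 : R) • v) = 0
      have hcomm : f.lTensor N v = ι.rTensor G (f.lTensor _ u) := by
        rw [← LinearMap.comp_apply, ← LinearMap.comp_apply, LinearMap.lTensor_comp_rTensor,
          LinearMap.rTensor_comp_lTensor]
      rw [one_smul, hcomm, hu, map_zero])
    have hv0 : (1 : R) • v = 0 := DFunLike.congr_fun hφ (Submodule.Quotient.mk 1)
    rw [one_smul] at hv0
    exact Module.Flat.rTensor_preserves_injective_linearMap ι hinj (hv0.trans (map_zero _).symm)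
  | succ e ih =>
    obtain ⟨x, hx, N', S, hN', hS⟩ := exists_regular_ses (h 0 e.succ_pos)
    refine ih (N := N') (fun j hj => ExtZ.co_right S (h j (by omega)) (h (j + 1) (by omega)))
      (fun h' => he (ExtZ.succ_of_smul S hS (smul_residue_eq_zero hx) h')) ?_
    refine ExtInj.right (S.rTensor F) (S.rTensor G) (f.lTensor N) (f.lTensor N) (f.lTensor N') ?_ ?_
      hf (extZ_tensor h F e.lt_succ_self)
    · exact TensorProduct.ext' fun _ _ => rfl
    · exact TensorProduct.ext' fun _ _ => rfl

section LowerBound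

variable {d : ℕ} {A B C : Type u} [AddCommGroup A] [Module R A] [AddCommGroup B] [Module R B]
    [AddCommGroup C] [Module R C]

lemma extZ_of_flat (hd : ∀ i < d, ExtZ R i (R ⧸ maximalIdeal R) R) [Module.Flat R A] {i : ℕ}
    (hi : i < d) : ExtZ R i (R ⧸ maximalIdeal R) A :=
  (extZ_tensor hd A hi).congr_right (TensorProduct.lid R A)

lemma GF.extZ (hd : ∀ i < d, ExtZ R i (R ⧸ maximalIdeal R) R) (hA : GF R A) {i : ℕ}
    (hi : i < d) : ExtZ R i (R ⧸ maximalIdeal R) A := by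
  induction i generalizing A with
  | zero =>
    obtain ⟨F, C, hF, ⟨S⟩, hC⟩ := hA.exists_embedding
    exact (extZ_of_flat hd hi).zero_of_injective S.inj
  | succ i ih =>
    obtain ⟨F, C, hF, ⟨S⟩, hC⟩ := hA.exists_embedding
    exact ExtZ.co_left S (extZ_of_flat hd hi) (ih hC (by omega))

lemma FD.extZ (hd : ∀ i < d, ExtZ R i (R ⧸ maximalIdeal R) R) {n : ℕ} (hA : FD R n A) {i : ℕ}
    (hi : i + n < d) : ExtZ R i (R ⧸ maximalIdeal R) A := by
  induction n generalizing A i with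
  | zero =>
    have := hA.flat
    exact extZ_of_flat hd hi
  | succ n ih =>
    obtain ⟨G, hG, π, hπ⟩ := exists_free_cover (R := R) A
    exact ExtZ.co_right (SES.ofSurj π hπ) (extZ_of_flat hd (by omega))
      (ih (FD.left (SES.ofSurj π hπ) (fd_of_flat n) hA) (by omega))

lemma GD.extZ (hd : ∀ i < d, ExtZ R i (R ⧸ maximalIdeal R) R) {n : ℕ} (hA : GD R n A) {i : ℕ}
    (hi : i + n < d) : ExtZ R i (R ⧸ maximalIdeal R) A := by
  obtain ⟨H, C, ⟨S⟩, hH, hC⟩ := hA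
  cases i with
  | zero => exact (hH.extZ hd hi).zero_of_injective S.inj
  | succ i => exact ExtZ.co_left S (hH.extZ hd hi) (hC.extZ hd (by omega))

end LowerBound

end Depth

end GFlat

namespace GFlat

open CategoryTheory Abelian IsLocalRing TensorProduct

variable {R : Type u} [CommRing R]

section Tensor

variable {A B C F G : Type u} [AddCommGroup A] [Module R A] [AddCommGroup B] [Module R B]
    [AddCommGroup C] [Module R C] [AddCommGroup F] [Module R F] [AddCommGroup G] [Module R G]

lemma SES.lTensor_rTensor_f (S : SES R A B C) [Module.Flat R F] [Module.Flat R G] (f : F →ₗ[R] G)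
    (u : A ⊗[R] F) : f.lTensor B ((S.rTensor F).f u) = (S.rTensor G).f (f.lTensor A u) := by
  change f.lTensor B (S.f.rTensor F u) = S.f.rTensor G (f.lTensor A u)
  rw [← LinearMap.comp_apply, ← LinearMap.comp_apply, LinearMap.lTensor_comp_rTensor,
    LinearMap.rTensor_comp_lTensor]

lemma SES.lTensor_rTensor_g (S : SES R A B C) [Module.Flat R F] [Module.Flat R G] (f : F →ₗ[R] G)
    (u : B ⊗[R] F) : f.lTensor C ((S.rTensor F).g u) = (S.rTensor G).g (f.lTensor B u) := by
  change f.lTensor C (S.g.rTensor F u) = S.g.rTensor G (f.lTensor B u)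
  rw [← LinearMap.comp_apply, ← LinearMap.comp_apply, LinearMap.lTensor_comp_rTensor,
    LinearMap.rTensor_comp_lTensor]

lemma SES.lTensor_injective (S : SES R A B C) [Module.Flat R F] [Module.Flat R G] {f : F →ₗ[R] G}
    (hA : Function.Injective (f.lTensor A)) (hC : Function.Injective (f.lTensor C)) :
    Function.Injective (f.lTensor B) := by
  rw [injective_iff_map_eq_zero]
  intro u hu
  obtain ⟨v, rfl⟩ := (S.rTensor F).lift (hC (by
    rw [S.lTensor_rTensor_g, hu, map_zero, map_zero]))
  rw [S.lTensor_rTensor_f] at hu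
  rw [hA (((S.rTensor G).inj (hu.trans (map_zero _).symm)).trans (map_zero _).symm), map_zero]

lemma XCpl.quotient_tensor [IsNoetherianRing R] {x : R} (h : XCpl x F) (I : Ideal R) :
    XCpl x ((R ⧸ I) ⊗[R] F) := by
  obtain ⟨k, a, ha⟩ := Submodule.fg_iff_exists_fin_generating_family.1 (IsNoetherian.noetherian I)
  have hex : Function.Exact (Fintype.linearCombination R a) I.mkQ := by
    intro r
    change _ ↔ r ∈ LinearMap.range (Fintype.linearCombination R a)
    rw [Fintype.range_linearCombination, ha]
    exact Submodule.Quotient.mk_eq_zero I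
  have hfree : XCpl x ((Fin k → R) ⊗[R] F) := (h.pi (Fin k)).congr
    (TensorProduct.comm R _ _ ≪≫ₗ TensorProduct.piScalarRight R R F (Fin k)).symm
  exact XCpl.right hfree (h.congr (TensorProduct.lid R F).symm)
    (_root_.rTensor_exact F hex I.mkQ_surjective)
    (LinearMap.rTensor_surjective F I.mkQ_surjective)

/-- Injectivity after tensoring with the residue field spreads to all cyclic modules, when the
source is complete. -/
lemma quotient_lTensor_injective [IsLocalRing R] [IsNoetherianRing R] [Module.Flat R F]
    [Module.Flat R G] {xs : List R} (hxs : Ideal.span {x | x ∈ xs} = maximalIdeal R)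
    (hF : ∀ x ∈ xs, XCpl x F) {f : F →ₗ[R] G}
    (hf : Function.Injective (f.lTensor (R ⧸ maximalIdeal R))) (I : Ideal R) :
    Function.Injective (f.lTensor (R ⧸ I)) := by
  induction I using WellFoundedGT.induction with
  | ind I ih =>
    by_cases htop : I = ⊤
    · have : Subsingleton (R ⧸ I) := Submodule.Quotient.subsingleton_iff.2 htop
      exact Function.injective_of_subsingleton _
    by_cases hp : I.IsPrime
    · by_cases hI : maximalIdeal R ≤ I
      · rwa [← le_antisymm hI (le_maximalIdeal htop)]
      · rw [← hxs, Ideal.span_le, Set.not_subset] at hI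
        obtain ⟨x, hx, hxI⟩ := hI
        let S := SES.colon (I := I) (K := I) x fun r => ⟨fun hr => I.mul_mem_right x hr,
          fun hr => (hp.mem_or_mem hr).resolve_right hxI⟩
        have hS : S.f = x • LinearMap.id := by
          ext
          change I.mkQ (1 * x) = x • I.mkQ 1
          rw [← map_smul, smul_eq_mul, mul_comm]
        have hS' : ∀ (E : Type u) [AddCommGroup E] [Module R E] [Module.Flat R E]
            (u : (R ⧸ I) ⊗[R] E), (S.rTensor E).f u = x • u := fun E _ _ _ u => by
          rw [S.rTensor_smul hS E]
          rfl
        have hC := ih (I ⊔ Ideal.span {x}) (lt_of_le_of_ne le_sup_left fun hh => hxI (by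
          rw [hh]
          exact Ideal.mem_sup_right (Ideal.mem_span_singleton_self x)))
        rw [← LinearMap.ker_eq_bot]
        refine ((hF x hx).quotient_tensor I).eq_bot_of_le_smul _ fun u hu => ?_
        rw [LinearMap.mem_ker] at hu
        obtain ⟨v, rfl⟩ := (S.rTensor F).lift (hC (by
          rw [S.lTensor_rTensor_g, hu, map_zero, map_zero]))
        rw [S.lTensor_rTensor_f] at hu
        exact ⟨v, (S.rTensor G).inj (hu.trans (map_zero _).symm), (hS' F v).symm⟩
    · rw [Ideal.isPrime_iff] at hp
      push Not at hp
      obtain ⟨a, b, hab, ha, hb⟩ := hp htop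
      have S := SES.colon (I := I) (K := I.colon {b}) b fun r => by
        rw [Submodule.mem_colon_singleton, smul_eq_mul]
      refine S.lTensor_injective (ih _ (lt_of_le_of_ne ?_ ?_))
        (ih _ (lt_of_le_of_ne le_sup_left fun hh => hb ?_))
      · intro r hr
        rw [Submodule.mem_colon_singleton]
        exact I.mul_mem_right b hr
      · intro hh
        refine ha ?_
        rw [hh, Submodule.mem_colon_singleton]
        exact hab
      · rw [hh]
        exact Ideal.mem_sup_right (Ideal.mem_span_singleton_self b)

end Tensor

section Complete

variable {A B C F G : Type u} [AddCommGroup A] [Module R A] [AddCommGroup B] [Module R B]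
    [AddCommGroup C] [Module R C] [AddCommGroup F] [Module R F] [AddCommGroup G] [Module R G]

lemma extInj_equiv {N : Type u} [AddCommGroup N] [Module R N] (i : ℕ) (e : A ≃ₗ[R] B) :
    ExtInj i N e.toLinearMap := by
  intro z hz
  have h := congrArg (fun y => Abelian.Ext.comp y
    (Abelian.Ext.mk₀ (ModuleCat.ofHom e.symm.toLinearMap)) (add_zero i)) hz
  simp only [Abelian.Ext.zero_comp] at h
  rw [Abelian.Ext.comp_assoc_of_second_deg_zero, Abelian.Ext.mk₀_comp_mk₀,
    ← ModuleCat.ofHom_comp, LinearEquiv.symm_comp, ModuleCat.ofHom_id,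
    Abelian.Ext.comp_mk₀_id] at h
  exact h

variable [IsLocalRing R] [IsNoetherianRing R] {xs : List R} {d : ℕ}

lemma quotient_lTensor_injective_of_extInj [Module.Flat R F] [Module.Flat R G]
    (hxs : Ideal.span {x | x ∈ xs} = maximalIdeal R)
    (hd : ∀ i < d, ExtZ R i (R ⧸ maximalIdeal R) R) (hd' : ¬ ExtZ R d (R ⧸ maximalIdeal R) R)
    (hF : ∀ x ∈ xs, XCpl x F) {f : F →ₗ[R] G} (hf : ExtInj d (R ⧸ maximalIdeal R) f)
    (I : Ideal R) : Function.Injective (f.lTensor (R ⧸ I)) := by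
  refine quotient_lTensor_injective hxs hF (residue_lTensor_injective hd hd' f ?_) I
  have h : f.lTensor R = (TensorProduct.lid R G).symm.toLinearMap ∘ₗ f ∘ₗ
      (TensorProduct.lid R F).toLinearMap := by
    ext x
    simp
  rw [h]
  exact ((extInj_equiv d _).comp hf).comp (extInj_equiv d _)

/-- Over complete modules, flat dimension is detected by depth. -/
lemma FD.pred_of_extZ (hxs : Ideal.span {x | x ∈ xs} = maximalIdeal R)
    (hd : ∀ i < d, ExtZ R i (R ⧸ maximalIdeal R) R) (hd' : ¬ ExtZ R d (R ⧸ maximalIdeal R) R)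
    (hA : ∀ x ∈ xs, XCpl x A) {n : ℕ} (h : FD R (n + 1) A)
    (hZ : ∀ i, i + (n + 1) ≤ d → ExtZ R i (R ⧸ maximalIdeal R) A) : FD R n A := by
  induction n generalizing A with
  | zero =>
    obtain ⟨P, π, hP, hπ, hPx⟩ := exists_complete_flat_cover xs hA
    let S := SES.ofSurj π hπ
    have hK : Module.Flat R (LinearMap.ker π) := FD.flat_left S h
    have hinj := quotient_lTensor_injective_of_extInj hxs hd hd'
      (fun x hx => XCpl.left S (hPx x hx) (hA x hx)) (extInj_left S fun j hj => hZ j hj)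
    have := flat_of_tv fun I => tv_one_of_lTensor_injective S (tv_of_flat 0) (hinj I)
    exact fd_of_flat 0
  | succ n ih =>
    obtain ⟨P, π, hP, hπ, hPx⟩ := exists_complete_flat_cover xs hA
    let S := SES.ofSurj π hπ
    refine FD.right S (ih (fun x hx => XCpl.left S (hPx x hx) (hA x hx))
      (FD.left S (fd_of_flat _) h) fun i hi => ?_) (fd_of_flat _)
    cases i with
    | zero => exact (extZ_of_flat hd (by omega)).zero_of_injective S.inj
    | succ i => exact ExtZ.co_left S (extZ_of_flat hd (by omega)) (hZ i (by omega))

lemma GD.pred_of_extZ (hxs : Ideal.span {x | x ∈ xs} = maximalIdeal R)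
    (hd : ∀ i < d, ExtZ R i (R ⧸ maximalIdeal R) R) (hd' : ¬ ExtZ R d (R ⧸ maximalIdeal R) R)
    (hA : ∀ x ∈ xs, XCpl x A) {n : ℕ} (h : GD R (n + 1) A)
    (hZ : ∀ i, i + (n + 1) ≤ d → ExtZ R i (R ⧸ maximalIdeal R) A) : GD R n A := by
  obtain ⟨H, C, ⟨S⟩, hH, hC, hHx⟩ := exists_complete_ses h xs hA
  exact ⟨H, C, ⟨S⟩, FD.pred_of_extZ hxs hd hd' hHx hH fun i hi =>
    ExtZ.co_mid S (hZ i hi) (hC.extZ hd (by omega)), hC⟩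

lemma GD.subsingleton_of_extZ (hxs : Ideal.span {x | x ∈ xs} = maximalIdeal R)
    (hd : ∀ i < d, ExtZ R i (R ⧸ maximalIdeal R) R) (hd' : ¬ ExtZ R d (R ⧸ maximalIdeal R) R)
    (hA : ∀ x ∈ xs, XCpl x A) (h : GD R 0 A)
    (hZ : ∀ i, i ≤ d → ExtZ R i (R ⧸ maximalIdeal R) A) : Subsingleton A := by
  obtain ⟨H, C, ⟨S⟩, hH, hC, hHx⟩ := exists_complete_ses h xs hA
  obtain ⟨F, D, hF, ⟨T⟩, hD⟩ := hC.exists_embedding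
  have := hH.flat
  have hinj := quotient_lTensor_injective_of_extInj hxs hd hd' hHx
    ((extInj_of_extZ S (hZ d le_rfl)).comp (extInj_left T fun j hj => hD.extZ hd hj)) ⊥
  have hg : Function.Injective (T.f ∘ₗ S.g) := by
    rw [injective_iff_map_eq_zero]
    intro h hh
    have h0 : (Submodule.Quotient.mk (1 : R) : R ⧸ (⊥ : Ideal R)) ⊗ₜ[R] h = 0 := by
      refine hinj ?_
      rw [LinearMap.lTensor_tmul, hh, tmul_zero, map_zero]
    have h1 := congrArg ((TensorProduct.lid R H).toLinearMap ∘ₗ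
      ((⊥ : Ideal R).liftQ LinearMap.id bot_le).rTensor H) h0
    rw [map_zero] at h1
    exact (one_smul R h).symm.trans h1
  refine ⟨fun a b => S.inj (hg ?_)⟩
  change T.f (S.g (S.f a)) = T.f (S.g (S.f b))
  rw [S.gf, S.gf]

end Complete

end GFlat

namespace GFlat

open CategoryTheory Abelian IsLocalRing TensorProduct

variable {R : Type u} [CommRing R]

section FlatTensor

variable {A B C N P : Type u} [AddCommGroup A] [Module R A] [AddCommGroup B] [Module R B]
    [AddCommGroup C] [Module R C] [AddCommGroup N] [Module R N] [AddCommGroup P] [Module R P]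

lemma lTensor_rTensor_injective_iff (f : A →ₗ[R] B) :
    Function.Injective ((f.rTensor P).lTensor N) ↔
      Function.Injective ((f.lTensor N).rTensor P) := by
  have h : (f.rTensor P).lTensor N = (TensorProduct.assoc R N B P).toLinearMap ∘ₗ
      (f.lTensor N).rTensor P ∘ₗ (TensorProduct.assoc R N A P).symm.toLinearMap := by
    refine TensorProduct.ext (LinearMap.ext fun n => TensorProduct.ext' fun a p => ?_)
    rfl
  rw [h]
  simp [LinearMap.coe_comp]

variable (P) in
lemma TV.tensor [Module.Flat R P] {i : ℕ} (h : TV R (i + 1) N A) : TV R (i + 1) N (A ⊗[R] P) := by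
  induction i generalizing A with
  | zero =>
    obtain ⟨G, hG, π, hπ⟩ := exists_free_cover (R := R) A
    let S := SES.ofSurj π hπ
    have hGf : Module.Flat R G := inferInstance
    have : Module.Flat R (G ⊗[R] P) := inferInstance
    refine tv_one_of_lTensor_injective (S.rTensor P) (tv_of_flat 0) ?_
    exact (lTensor_rTensor_injective_iff S.f).2
      (Module.Flat.rTensor_preserves_injective_linearMap _ (h.lTensor_injective S))
  | succ i ih =>
    obtain ⟨G, hG, π, hπ⟩ := exists_free_cover (R := R) A
    let S := SES.ofSurj π hπ
    have hGf : Module.Flat R G := inferInstance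
    have : Module.Flat R (G ⊗[R] P) := inferInstance
    exact TV.right (S.rTensor P) (ih (TV.left S (tv_of_flat i) h)) (tv_of_flat _)

lemma TV.of_tensor [Module.FaithfullyFlat R P] {i : ℕ} (h : TV R (i + 1) N (A ⊗[R] P)) :
    TV R (i + 1) N A := by
  induction i generalizing A with
  | zero =>
    obtain ⟨G, hG, π, hπ⟩ := exists_free_cover (R := R) A
    let S := SES.ofSurj π hπ
    have hGf : Module.Flat R G := inferInstance
    refine tv_one_of_lTensor_injective S (tv_of_flat 0) ?_
    have h1 := (lTensor_rTensor_injective_iff S.f).1 (h.lTensor_injective (S.rTensor P))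
    rw [← LinearMap.lTensor_inj_iff_rTensor_inj] at h1
    exact (Module.FaithfullyFlat.lTensor_injective_iff_injective R P _).1 h1
  | succ i ih =>
    obtain ⟨G, hG, π, hπ⟩ := exists_free_cover (R := R) A
    let S := SES.ofSurj π hπ
    have hGf : Module.Flat R G := inferInstance
    have : Module.Flat R (G ⊗[R] P) := inferInstance
    exact TV.right S (ih (TV.left (S.rTensor P) (tv_of_flat i) h)) (tv_of_flat _)

variable (P) in
lemma FD.tensor [Module.Flat R P] {n : ℕ} (h : FD R n A) : FD R n (A ⊗[R] P) := fun N i hi => by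
  obtain ⟨i, rfl⟩ : ∃ j, i = j + 1 := ⟨i - 1, by omega⟩
  exact (h N _ hi).tensor P

variable (P) in
lemma GF.tensor [Module.Flat R P] (h : GF R A) : GF R (A ⊗[R] P) := by
  refine ⟨fun B => ∃ A : ModuleCat.{u} R, GF R A ∧ Nonempty (A ⊗[R] P ≃ₗ[R] B),
    ⟨ModuleCat.of R A, h, ⟨LinearEquiv.refl R _⟩⟩, ?_⟩
  rintro B ⟨A, hA, ⟨e⟩⟩
  obtain ⟨F, C, hF, ⟨S⟩, hC⟩ := hA.exists_embedding
  exact ⟨InjAcyclic.congr (fun E hE i => (hA.injAcyclic E hE i).tensor P) e,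
    ModuleCat.of R (F ⊗[R] P), ModuleCat.of R (C ⊗[R] P),
    inferInstanceAs (Module.Flat R (F ⊗[R] P)), ⟨(S.rTensor P).congrLeft e.symm⟩,
    C, hC, ⟨LinearEquiv.refl R _⟩⟩

variable (P) in
lemma GD.tensor [Module.Flat R P] {n : ℕ} (h : GD R n A) : GD R n (A ⊗[R] P) := by
  obtain ⟨H, C, ⟨S⟩, hH, hC⟩ := h
  exact ⟨ModuleCat.of R (H ⊗[R] P), ModuleCat.of R (C ⊗[R] P), ⟨S.rTensor P⟩, hH.tensor P,
    hC.tensor P⟩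

lemma GD.pred_of_tv {n : ℕ} (h : GD R (n + 1) A)
    (h' : ∀ E : ModuleCat.{u} R, Module.Injective R E → TV R (n + 1) E A) : GD R n A := by
  obtain ⟨H, C, ⟨S⟩, hH, hC⟩ := h
  exact ⟨H, C, ⟨S⟩, hH.pred_of_injective fun E hE =>
    TV.mid S (h' E hE) (hC.injAcyclic E hE n), hC⟩

lemma GD.tv {n : ℕ} (h : GD R n A) (E : ModuleCat.{u} R) (hE : Module.Injective R E) :
    TV R (n + 1) E A := by
  obtain ⟨H, C, ⟨S⟩, hH, hC⟩ := h
  exact TV.left S (hH E _ n.lt_succ_self) (hC.injAcyclic E hE _)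

end FlatTensor

section Finite

variable [IsLocalRing R] [IsNoetherianRing R]

lemma faithfullyFlat_adicCompletion :
    Module.FaithfullyFlat R (AdicCompletion (maximalIdeal R) R) := by
  refine ⟨fun {m} hm h => ?_⟩
  rw [IsLocalRing.eq_maximalIdeal hm] at h
  have hc := AdicCompletion.isAdicComplete (M := R) (IsNoetherian.noetherian (maximalIdeal R))
  have hpow : ∀ n : ℕ, (maximalIdeal R ^ n • ⊤ : Submodule R (AdicCompletion (maximalIdeal R) R)) =
      ⊤ := fun n => by
    induction n with
    | zero => rw [pow_zero, Ideal.one_eq_top, Submodule.top_smul]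
    | succ n ih => rw [pow_succ, Submodule.mul_smul, h, ih]
  have h0 : AdicCompletion.of (maximalIdeal R) R 1 = 0 :=
    hc.toIsHausdorff.haus _ fun n => by rw [SModEq.zero, hpow]; trivial
  exact one_ne_zero (AdicCompletion.of_injective (maximalIdeal R) R (h0.trans (map_zero _).symm))

lemma xCpl_tensor_adicCompletion {A : Type u} [AddCommGroup A] [Module R A] [Module.Finite R A]
    {x : R} (hx : x ∈ maximalIdeal R) :
    XCpl x (A ⊗[R] AdicCompletion (maximalIdeal R) R) := by
  have hc := AdicCompletion.isAdicComplete (M := A) (IsNoetherian.noetherian (maximalIdeal R))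
  have h : XCpl x (AdicCompletion (maximalIdeal R) A) := xCpl_of_isAdicComplete (maximalIdeal R) hx
  exact h.congr (((AdicCompletion.ofTensorProductEquivOfFiniteNoetherian (maximalIdeal R)
    A).restrictScalars R).symm ≪≫ₗ TensorProduct.comm R _ _)

end Finite

section Depth

variable {A : Type u} [AddCommGroup A] [Module R A]

lemma sInf_image_natCast_eq {P : ℕ → Prop} {n : ℕ} (hn : P n) (hmin : ∀ k < n, ¬ P k) :
    sInf ((↑) '' {k | P k}) = (n : ℕ∞) := by
  refine le_antisymm (sInf_le ⟨n, hn, rfl⟩) (le_sInf ?_)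
  rintro _ ⟨k, hk, rfl⟩
  exact Nat.cast_le.2 (not_lt.1 fun h => hmin k h hk)

lemma idealDepth_eq_top {I : Ideal R} (h : ∀ i, ExtZ R i (R ⧸ I) A) : idealDepth R I A = ⊤ := by
  simp [idealDepth, subsingleton_extModule_iff, h]

lemma idealDepth_eq {I : Ideal R} {i : ℕ} (h : ¬ ExtZ R i (R ⧸ I) A)
    (h' : ∀ j < i, ExtZ R j (R ⧸ I) A) : idealDepth R I A = i :=
  sInf_image_natCast_eq (by rwa [subsingleton_extModule_iff])
    fun j hj => not_not.2 ((subsingleton_extModule_iff j).2 (h' j hj))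

end Depth

section Formula

variable [IsLocalRing R] [IsNoetherianRing R] {d : ℕ} {A : Type u} [AddCommGroup A] [Module R A]

lemma exists_list_span_maximalIdeal (R : Type u) [CommRing R] [IsLocalRing R] [IsNoetherianRing R] :
    ∃ xs : List R, Ideal.span {x | x ∈ xs} = maximalIdeal R := by
  obtain ⟨s, hs⟩ := IsNoetherian.noetherian (maximalIdeal R)
  refine ⟨s.toList, ?_⟩
  rw [← hs]
  congr 1
  ext x
  simp

/-- The depth of a nonzero module of Gorenstein flat dimension exactly `n`. -/
lemma exists_not_extZ [Nontrivial A]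
    (hA : Module.Finite R A ∨ IsAdicComplete (maximalIdeal R) A)
    (hd : ∀ i < d, ExtZ R i (R ⧸ maximalIdeal R) R) (hd' : ¬ ExtZ R d (R ⧸ maximalIdeal R) R)
    {n : ℕ} (h : GD R n A) (hn : ∀ k < n, ¬ GD R k A) :
    ∃ i, i + n ≤ d ∧ ¬ ExtZ R i (R ⧸ maximalIdeal R) A := by
  obtain ⟨xs, hxs⟩ := exists_list_span_maximalIdeal R
  have hmem : ∀ x ∈ xs, x ∈ maximalIdeal R := fun x hx => hxs ▸ Ideal.subset_span hx
  by_contra! hZ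
  rcases hA with hA | hA
  · let P := AdicCompletion (maximalIdeal R) R
    have hP : Module.FaithfullyFlat R P := faithfullyFlat_adicCompletion
    have hx : ∀ x ∈ xs, XCpl x (A ⊗[R] P) := fun x hx => xCpl_tensor_adicCompletion (hmem x hx)
    have hZ' : ∀ i, i + n ≤ d → ExtZ R i (R ⧸ maximalIdeal R) (A ⊗[R] P) := fun i hi =>
      extZ_tensor (e := i + 1) (fun j hj => hZ j (by omega)) P i.lt_succ_self
    cases n with
    | zero =>
      have := (h.tensor P).subsingleton_of_extZ hxs hd hd' hx hZ'
      exact not_subsingleton A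
        ((Module.FaithfullyFlat.subsingleton_tensorProduct_iff_left R A).1 this)
    | succ n =>
      exact hn n n.lt_succ_self (h.pred_of_tv fun E hE =>
        (((h.tensor P).pred_of_extZ hxs hd hd' hx hZ').tv E hE).of_tensor)
  · have hx : ∀ x ∈ xs, XCpl x A := fun x hx => xCpl_of_isAdicComplete (maximalIdeal R) (hmem x hx)
    cases n with
    | zero => exact not_subsingleton A (h.subsingleton_of_extZ hxs hd hd' hx hZ)
    | succ n => exact hn n n.lt_succ_self (h.pred_of_extZ hxs hd hd' hx hZ)

end Formula

end GFlat

open GFlat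

/-- **Auslander–Buchsbaum formula for Gorenstein flat dimension.** If `(R, m)` is a
noetherian local ring and `M` is a non-zero finitely generated or `m`-adically complete
`R`-module of finite Gorenstein flat dimension, then
`Gfd_R M = depth (m, R) - depth_R (m, M)`. -/
theorem gfd_eq_depth_sub_depth {R : Type u} [CommRing R] [IsLocalRing R]
    [IsNoetherianRing R] (M : Type u) [AddCommGroup M] [Module R M] [Nontrivial M]
    (hM : Module.Finite R M ∨ IsAdicComplete (IsLocalRing.maximalIdeal R) M)
    (hfin : gfd R M < ⊤) :
    gfd R M + idealDepth R (IsLocalRing.maximalIdeal R) M =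
      idealDepth R (IsLocalRing.maximalIdeal R) R := by
  classical
  have hex : ∃ n, GD R n M := by
    by_contra! h
    simp [gfd, gfdLE_iff_gd, h] at hfin
  have hgfd : gfd R M = Nat.find hex :=
    sInf_image_natCast_eq (gfdLE_iff_gd.2 (Nat.find_spec hex))
      fun k hk h => Nat.find_min hex hk (gfdLE_iff_gd.1 h)
  rw [hgfd]
  by_cases hR : ∃ d, ¬ ExtZ R d (R ⧸ IsLocalRing.maximalIdeal R) R
  · have hd : ∀ i < Nat.find hR, ExtZ R i (R ⧸ IsLocalRing.maximalIdeal R) R :=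
      fun i hi => not_not.1 (Nat.find_min hR hi)
    obtain ⟨i, hi, hZ⟩ := exists_not_extZ hM hd (Nat.find_spec hR) (Nat.find_spec hex)
      fun k hk => Nat.find_min hex hk
    have hlow : Nat.find hR ≤ i + Nat.find hex :=
      not_lt.1 fun h => hZ (GD.extZ hd (Nat.find_spec hex) h)
    rw [idealDepth_eq hZ fun j hj => GD.extZ hd (Nat.find_spec hex) (by omega),
      idealDepth_eq (Nat.find_spec hR) hd, ← Nat.cast_add, add_comm, le_antisymm hi hlow]
  · push Not at hR
    rw [idealDepth_eq_top hR, idealDepth_eq_top fun i =>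
      GD.extZ (d := i + Nat.find hex + 1) (fun j _ => hR j) (Nat.find_spec hex) (by omega), add_top]
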